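/- arXiv:2410.16188 — 6 statements merged into one kernel-verified Lean document; each statement's English description precedes it below -/
import Mathlib

section
/- Let e_d = (0, …, 0, 1) ∈ ℝ^d. Then ∫_{ℝ^d \ B(0,1)} (|z| − 1)^{-α/2} · min(|e_d − z|^{-d}, |e_d − z|^{-d+1}) dz < ∞. -/
open MeasureTheory Set Metric

/-- The height of the upper unit hemisphere above a point of the equatorial hyperplane. -/
noncomputable def hemisphereHeight {n : ℕ} (x : Fin n → ℝ) : ℝ := √(1 - ∑ i, x i ^ 2)

/-- Coordinates in which the upper unit hemisphere is flat: the horizontal part of a point and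
its vertical distance to the hemisphere. -/
noncomputable def flattenSphere {n : ℕ} (z : EuclideanSpace ℝ (Fin (n + 1))) :
    (Fin n → ℝ) × ℝ :=
  (fun i => z i.castSucc, z (Fin.last n) - hemisphereHeight fun i => z i.castSucc)

theorem measurePreserving_flattenSphere (n : ℕ) :
    MeasurePreserving (flattenSphere (n := n)) volume volume := by
  have hh : Measurable (hemisphereHeight (n := n)) := by
    unfold hemisphereHeight
    fun_prop
  have hflat : Measurable (flattenSphere (n := n)) := by
    unfold flattenSphere
    fun_prop
  have hskew : MeasurePreserving
      (fun p : (Fin n → ℝ) × ℝ => (p.1, p.2 - hemisphereHeight p.1))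
      (volume.prod volume) (volume.prod volume) :=
    (MeasurePreserving.id volume).skew_product (g := fun x y => y - hemisphereHeight x)
      (by unfold Function.uncurry; fun_prop)
      (Filter.Eventually.of_forall fun x => (measurePreserving_sub_right volume _).map_eq)
  exact ((hskew.comp Measure.measurePreserving_swap).comp
    (volume_preserving_piFinSuccAbove (fun _ : Fin (n + 1) => ℝ) (Fin.last n))).comp
      (PiLp.volume_preserving_ofLp (Fin (n + 1))) |>.congr hflat
    (Filter.Eventually.of_forall fun z => by
      simp [flattenSphere, MeasurableEquiv.piFinSuccAbove, Fin.init_def])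

theorem integrable_indicator_rpow_norm {n : ℕ} (hn : 1 ≤ n) {ε : ℝ} (hε : 0 < ε) :
    Integrable fun x : Fin n → ℝ => (Ioo (0 : ℝ) 1).indicator (· ^ (-(n : ℝ) + ε)) ‖x‖ := by
  have : Nonempty (Fin n) := ⟨⟨0, hn⟩⟩
  rw [integrable_fun_norm_addHaar volume (f := (Ioo (0 : ℝ) 1).indicator (· ^ (-(n : ℝ) + ε)))]
  have h : IntegrableOn (fun y : ℝ => y ^ (-1 + ε)) (Ioo 0 1) :=
    (intervalIntegral.integrableOn_Ioo_rpow_iff one_pos).2 (by linarith)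
  rw [← integrable_indicator_iff measurableSet_Ioo] at h
  refine h.integrableOn.congr_fun (fun y hy => ?_) measurableSet_Ioi
  have hy : 0 < y := hy
  by_cases hy1 : y ∈ Ioo (0 : ℝ) 1
  · simp only [indicator_of_mem hy1, Module.finrank_fin_fun, smul_eq_mul]
    rw [← Real.rpow_natCast, ← Real.rpow_add hy, Nat.cast_sub hn]
    congr 1
    push_cast
    ring
  · simp [indicator_of_notMem hy1]

theorem integrable_indicator_div_rpow {b : ℝ} (hb : b < 1) (c T : ℝ) (hc : 0 < c) (hT : 0 < T) :
    Integrable ((Ioo (0 : ℝ) T).indicator fun s => (s / c) ^ (-b)) := by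
  rw [integrable_indicator_iff measurableSet_Ioo]
  have h : IntegrableOn (fun y : ℝ => y ^ (-b)) (Ioo 0 T) :=
    (intervalIntegral.integrableOn_Ioo_rpow_iff hT).2 (by linarith)
  refine IntegrableOn.congr_fun (h.mul_const (c ^ (-b))⁻¹) (fun s hs => ?_) measurableSet_Ioo
  rw [Real.div_rpow hs.1.le hc.le, div_eq_mul_inv]

theorem integrableOn_sub_one_rpow_mul_inv {b : ℝ} (hb0 : 0 < b) (hb1 : b < 1) :
    IntegrableOn (fun r : ℝ => (r - 1) ^ (-b) * r⁻¹) (Ioi 1) := by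
  have hnear : IntegrableOn (fun t : ℝ => t ^ (-b)) (Ioo 0 1) :=
    (intervalIntegral.integrableOn_Ioo_rpow_iff one_pos).2 (by linarith)
  have hfar : IntegrableOn (fun t : ℝ => t ^ (-b - 1)) (Ioi (1 / 2)) :=
    integrableOn_Ioi_rpow_of_lt (by linarith) (by norm_num)
  rw [← integrable_indicator_iff measurableSet_Ioo] at hnear
  rw [← integrable_indicator_iff measurableSet_Ioi] at hfar
  refine ((hnear.add hfar).comp_sub_right 1).integrableOn.mono'
    (by fun_prop) ((ae_restrict_iff' measurableSet_Ioi).2 (Filter.Eventually.of_forall ?_))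
  intro r hr
  have hr : 1 < r := hr
  have ht : 0 < r - 1 := by linarith
  have hp := Real.rpow_pos_of_pos ht (-b)
  rw [Real.norm_of_nonneg (by positivity)]
  simp only [Pi.add_apply]
  by_cases h : r - 1 ∈ Ioo (0 : ℝ) 1
  · rw [indicator_of_mem h]
    have h1 : (r - 1) ^ (-b) * r⁻¹ ≤ (r - 1) ^ (-b) :=
      mul_le_of_le_one_right hp.le (inv_le_one_of_one_le₀ hr.le)
    have h2 : 0 ≤ (Ioi (1 / 2 : ℝ)).indicator (fun t => t ^ (-b - 1)) (r - 1) :=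
      indicator_nonneg (fun t ht => Real.rpow_nonneg (by have : (1 / 2 : ℝ) < t := ht; linarith) _) _
    linarith
  · have h' : 1 ≤ r - 1 := by
      by_contra! h'
      exact h ⟨ht, h'⟩
    rw [indicator_of_notMem h, indicator_of_mem (show r - 1 ∈ Ioi (1 / 2 : ℝ) from mem_Ioi.2 (by linarith)), zero_add,
      Real.rpow_sub ht, Real.rpow_one, div_eq_mul_inv]
    gcongr
    linarith

theorem integrable_radial_majorant {n : ℕ} {b : ℝ} (hb0 : 0 < b) (hb1 : b < 1) :
    Integrable fun z : EuclideanSpace ℝ (Fin (n + 1)) =>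
      (Ioi (1 : ℝ)).indicator (fun r => (r - 1) ^ (-b) * r ^ (-((n + 1 : ℕ) : ℝ))) ‖z‖ := by
  rw [integrable_fun_norm_addHaar volume
    (f := (Ioi (1 : ℝ)).indicator (fun r => (r - 1) ^ (-b) * r ^ (-((n + 1 : ℕ) : ℝ))))]
  have h := integrableOn_sub_one_rpow_mul_inv hb0 hb1
  rw [← integrable_indicator_iff measurableSet_Ioi] at h
  refine h.integrableOn.congr_fun (fun y hy => ?_) measurableSet_Ioi
  have hy : 0 < y := hy
  by_cases hy1 : y ∈ Ioi (1 : ℝ)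
  · simp only [indicator_of_mem hy1, finrank_euclideanSpace_fin, smul_eq_mul]
    rw [Real.rpow_neg hy.le, Real.rpow_natCast, Nat.add_sub_cancel, pow_succ]
    field_simp
  · simp [indicator_of_notMem hy1]

theorem rpow_mul_rpow_le_of_le {n : ℕ} (hn : 1 ≤ n) {b ε m t s R : ℝ} (hb : 0 < b) (hε : 0 < ε)
    (hε1 : ε < 1) (hm : 0 < m) (hs : 0 < s) (hst : s / 5 ≤ t) (hmR : m ≤ R) (htR : t ≤ R) :
    t ^ (-b) * R ^ (-(n : ℝ)) ≤ m ^ (-(n : ℝ) + ε) * (s / 5) ^ (-(b + ε)) := by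
  have hs5 : 0 < s / 5 := by positivity
  have ht : 0 < t := by linarith
  have hR : 0 < R := by linarith
  have hn' : (1 : ℝ) ≤ n := by exact_mod_cast hn
  calc t ^ (-b) * R ^ (-(n : ℝ)) = t ^ (-b) * (R ^ (-(n : ℝ) + ε) * R ^ (-ε)) := by
        rw [← Real.rpow_add hR]
        congr 2
        ring
    _ ≤ t ^ (-b) * (m ^ (-(n : ℝ) + ε) * t ^ (-ε)) := by
        have h1 : R ^ (-(n : ℝ) + ε) ≤ m ^ (-(n : ℝ) + ε) :=
          Real.rpow_le_rpow_of_nonpos hm hmR (by linarith)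
        have h2 : R ^ (-ε) ≤ t ^ (-ε) := Real.rpow_le_rpow_of_nonpos ht htR (by linarith)
        gcongr
    _ = m ^ (-(n : ℝ) + ε) * t ^ (-(b + ε)) := by
        rw [neg_add, Real.rpow_add ht]
        ring
    _ ≤ m ^ (-(n : ℝ) + ε) * (s / 5) ^ (-(b + ε)) := by
        have h3 : t ^ (-(b + ε)) ≤ (s / 5) ^ (-(b + ε)) :=
          Real.rpow_le_rpow_of_nonpos hs5 hst (by linarith)
        gcongr

/-- Geometry of the flattening coordinates outside the unit ball, close to the north pole. -/
theorem flattenSphere_bounds {n : ℕ} {z : EuclideanSpace ℝ (Fin (n + 1))} (hz : 1 < ‖z‖)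
    (hze : ‖EuclideanSpace.single (Fin.last n) (1 : ℝ) - z‖ < 1 / 2) :
    ‖(flattenSphere z).1‖ ≤ ‖EuclideanSpace.single (Fin.last n) (1 : ℝ) - z‖ ∧
      (flattenSphere z).2 ∈ Ioo (0 : ℝ) 2 ∧ (flattenSphere z).2 / 5 ≤ ‖z‖ - 1 := by
  set e := EuclideanSpace.single (Fin.last n) (1 : ℝ) with he
  have hx : ∀ i : Fin n, (e - z) i.castSucc = -z i.castSucc := fun i => by
    simp [he, (Fin.castSucc_lt_last i).ne]
  have hy : (e - z) (Fin.last n) = 1 - z (Fin.last n) := by simp [he]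
  have hyR := PiLp.norm_apply_le (e - z) (Fin.last n)
  rw [hy, Real.norm_eq_abs] at hyR
  obtain ⟨hy1, hy2⟩ := abs_le.1 (hyR.trans hze.le)
  have hez := EuclideanSpace.real_norm_sq_eq (e - z)
  have hzz := EuclideanSpace.real_norm_sq_eq z
  rw [Fin.sum_univ_castSucc] at hez hzz
  simp only [hx, hy, neg_sq] at hez
  set S := ∑ i : Fin n, z i.castSucc ^ 2
  set y := z (Fin.last n)
  have hS4 : S ≤ 1 / 4 := by nlinarith [norm_nonneg (e - z), sq_nonneg (1 - y)]
  have hh : hemisphereHeight (fun i => z i.castSucc) ^ 2 = 1 - S := Real.sq_sqrt (by linarith)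
  have hh0 : 0 ≤ hemisphereHeight (fun i => z i.castSucc) := Real.sqrt_nonneg _
  have hz2 : ‖z‖ ≤ 3 / 2 := by
    have h1 : ‖e‖ = 1 := by simp [he]
    have h2 := norm_sub_norm_le z e
    rw [norm_sub_rev] at h2
    linarith
  have hsnd : (flattenSphere z).2 = y - hemisphereHeight fun i => z i.castSucc := rfl
  rw [hsnd]
  generalize hemisphereHeight (fun i => z i.castSucc) = h at *
  have hyh : h < y := by nlinarith
  refine ⟨(pi_norm_le_iff_of_nonneg (norm_nonneg _)).2 fun i => ?_, ⟨by linarith, by linarith⟩, ?_⟩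
  · have := PiLp.norm_apply_le (e - z) i.castSucc
    rwa [hx, norm_neg] at this
  · nlinarith

theorem integrable_flattened_majorant {n : ℕ} (hn : 1 ≤ n) {b ε : ℝ} (hε : 0 < ε)
    (hb : b + ε < 1) :
    Integrable fun z : EuclideanSpace ℝ (Fin (n + 1)) =>
      (Ioo (0 : ℝ) 1).indicator (· ^ (-(n : ℝ) + ε)) ‖(flattenSphere z).1‖ *
        (Ioo (0 : ℝ) 2).indicator (fun s => (s / 5) ^ (-(b + ε))) (flattenSphere z).2 :=
  (measurePreserving_flattenSphere n).integrable_comp_of_integrable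
    ((integrable_indicator_rpow_norm hn hε).mul_prod
      (integrable_indicator_div_rpow hb 5 2 (by norm_num) (by norm_num)))

theorem integrableOn_sub_one_rpow_mul_min {n : ℕ} (hn : 1 ≤ n) {b : ℝ} (hb0 : 0 < b)
    (hb1 : b < 1) :
    IntegrableOn
      (fun z : EuclideanSpace ℝ (Fin (n + 1)) =>
        (‖z‖ - 1) ^ (-b) *
          min (‖EuclideanSpace.single (Fin.last n) (1 : ℝ) - z‖ ^ (-((n + 1 : ℕ) : ℝ)))
            (‖EuclideanSpace.single (Fin.last n) (1 : ℝ) - z‖ ^ (-((n + 1 : ℕ) : ℝ) + 1)))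
      (ball (0 : EuclideanSpace ℝ (Fin (n + 1))) 1)ᶜ := by
  set ε := (1 - b) / 2 with hε
  have hε0 : 0 < ε := by linarith
  have : Nonempty (Fin n) := ⟨⟨0, hn⟩⟩
  have hne : ∀ᵐ z : EuclideanSpace ℝ (Fin (n + 1)), (flattenSphere z).1 ≠ 0 :=
    (Measure.quasiMeasurePreserving_fst.comp
      (measurePreserving_flattenSphere n).quasiMeasurePreserving).ae (Measure.ae_ne volume 0)
  refine ((integrable_flattened_majorant (b := b) hn hε0 (by linarith)).add
    ((integrable_radial_majorant (n := n) hb0 hb1).const_mul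
      (3 ^ ((n + 1 : ℕ) : ℝ)))).integrableOn.mono' (by fun_prop)
    ((ae_restrict_iff' measurableSet_ball.compl).2 ?_)
  filter_upwards [hne] with z hz0 hz
  have hz : 1 ≤ ‖z‖ := by simpa using hz
  simp only [Pi.add_apply]
  set e := EuclideanSpace.single (Fin.last n) (1 : ℝ) with he
  have hR0 := norm_nonneg (e - z)
  have ht0 : 0 ≤ ‖z‖ - 1 := by linarith
  have hnear_nonneg : 0 ≤ (Ioo (0 : ℝ) 1).indicator (· ^ (-(n : ℝ) + ε)) ‖(flattenSphere z).1‖ *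
      (Ioo (0 : ℝ) 2).indicator (fun s => (s / 5) ^ (-(b + ε))) (flattenSphere z).2 :=
    mul_nonneg (indicator_nonneg (fun s hs => Real.rpow_nonneg hs.1.le _) _)
      (indicator_nonneg (fun s hs => Real.rpow_nonneg (div_nonneg hs.1.le (by norm_num)) _) _)
  have hfar_nonneg : 0 ≤ 3 ^ ((n + 1 : ℕ) : ℝ) *
      (Ioi (1 : ℝ)).indicator (fun r => (r - 1) ^ (-b) * r ^ (-((n + 1 : ℕ) : ℝ))) ‖z‖ := by
    refine mul_nonneg (by positivity) (indicator_nonneg (fun r hr => ?_) _)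
    have hr : 1 < r := hr
    exact mul_nonneg (Real.rpow_nonneg (by linarith) _) (Real.rpow_nonneg (by linarith) _)
  rw [Real.norm_of_nonneg (by positivity)]
  rcases hz.eq_or_lt with hz1 | hz1
  · rw [show ‖z‖ - 1 = 0 by linarith, Real.zero_rpow (by linarith), zero_mul]
    exact add_nonneg hnear_nonneg hfar_nonneg
  have hzR : ‖z‖ - 1 ≤ ‖e - z‖ := by
    have h1 : ‖e‖ = 1 := by simp [he]
    have h2 := norm_sub_norm_le z e
    rw [norm_sub_rev] at h2
    linarith
  rcases lt_or_ge ‖e - z‖ (1 / 2) with hlt | hge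
  · obtain ⟨hm, hs, hst⟩ := flattenSphere_bounds hz1 hlt
    have hm0 : 0 < ‖(flattenSphere z).1‖ := norm_pos_iff.2 hz0
    refine le_add_of_le_of_nonneg ?_ hfar_nonneg
    rw [indicator_of_mem (show _ ∈ Ioo (0 : ℝ) 1 from ⟨hm0, by linarith⟩), indicator_of_mem hs]
    refine le_trans ?_ (rpow_mul_rpow_le_of_le hn hb0 hε0 (by linarith) hm0 hs.1 hst hm hzR)
    refine mul_le_mul_of_nonneg_left ((min_le_right _ _).trans_eq ?_) (Real.rpow_nonneg ht0 _)
    congr 1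
    push_cast
    ring
  · refine le_add_of_nonneg_of_le hnear_nonneg ?_
    rw [indicator_of_mem (show ‖z‖ ∈ Ioi (1 : ℝ) from hz1), mul_left_comm]
    refine mul_le_mul_of_nonneg_left ((min_le_left _ _).trans ?_) (Real.rpow_nonneg ht0 _)
    have h3 : ‖z‖ / 3 ≤ ‖e - z‖ := by linarith
    calc ‖e - z‖ ^ (-((n + 1 : ℕ) : ℝ)) ≤ (‖z‖ / 3) ^ (-((n + 1 : ℕ) : ℝ)) :=
          Real.rpow_le_rpow_of_nonpos (by positivity) h3 (neg_nonpos.2 (Nat.cast_nonneg _))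
      _ = 3 ^ ((n + 1 : ℕ) : ℝ) * ‖z‖ ^ (-((n + 1 : ℕ) : ℝ)) := by
          rw [Real.div_rpow (norm_nonneg z) (by norm_num), Real.rpow_neg (by norm_num : (0 : ℝ) ≤ 3),
            div_inv_eq_mul, mul_comm]

/-- With `e_d = (0,…,0,1) ∈ ℝ^d`, the integral
`∫_{ℝ^d \ B(0,1)} (|z|−1)^{-α/2} · min(|e_d−z|^{-d}, |e_d−z|^{-d+1}) dz`
is finite. -/
theorem stmt8 (d : ℕ) (hd : 2 ≤ d) (α : ℝ) (hα : α ∈ Set.Ioo (0 : ℝ) 2) :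
    IntegrableOn
      (fun z : EuclideanSpace ℝ (Fin d) =>
        (‖z‖ - 1) ^ (-(α / 2)) *
          min (‖EuclideanSpace.single (⟨d - 1, by omega⟩ : Fin d) (1 : ℝ) - z‖ ^ (-(d : ℝ)))
              (‖EuclideanSpace.single (⟨d - 1, by omega⟩ : Fin d) (1 : ℝ) - z‖ ^ (-(d : ℝ) + 1)))
      (ball (0 : EuclideanSpace ℝ (Fin d)) 1)ᶜ := by
  obtain ⟨n, rfl⟩ : ∃ n, d = n + 1 := ⟨d - 1, by omega⟩
  exact integrableOn_sub_one_rpow_mul_min (by omega) (by linarith [hα.1]) (by linarith [hα.2])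
end

section
/- There is a constant C = C(d,α) such that for every y ∈ B(0,1): ∫_{ℝ^d \ B(0,1)} (|z| − 1)^{-α/2} · min(|y − z|^{-d}, |y − z|^{-d+1}) dz ≤ C. -/
open MeasureTheory Set Metric
open scoped ENNReal

/-- The function `‖x‖ ^ (-p)`, with value `∞` at the origin, cut off outside the ball of
radius `R`. -/
noncomputable def truncNormRpow {E : Type*} [NormedAddCommGroup E] (p R : ℝ) : E → ℝ≥0∞ :=
  (ball (0 : E) R).indicator fun x => ‖x‖ₑ ^ (-p)

lemma measurable_truncNormRpow {E : Type*} [NormedAddCommGroup E] [MeasurableSpace E]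
    [BorelSpace E] (p R : ℝ) : Measurable (truncNormRpow p R : E → ℝ≥0∞) :=
  (measurable_enorm.pow_const _).indicator measurableSet_ball

lemma lintegral_truncNormRpow_lt_top {E : Type*} [NormedAddCommGroup E] [NormedSpace ℝ E]
    [FiniteDimensional ℝ E] [MeasurableSpace E] [BorelSpace E] [Nontrivial E]
    (μ : Measure E) [μ.IsAddHaarMeasure] {p R : ℝ} (hp : p < Module.finrank ℝ E) (hR : 0 < R) :
    ∫⁻ x, truncNormRpow p R x ∂μ < ∞ := by
  have hint : IntegrableOn (fun x : E => ‖x‖ ^ (-p)) (ball 0 R) μ := by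
    rw [integrableOn_fun_norm_addHaar μ (f := fun t : ℝ => t ^ (-p))]
    have hd : 1 ≤ Module.finrank ℝ E := Module.finrank_pos
    have h : IntegrableOn (fun t : ℝ => t ^ ((Module.finrank ℝ E : ℝ) - 1 - p)) (Ioo 0 R) :=
      (intervalIntegral.integrableOn_Ioo_rpow_iff hR).2 (by linarith)
    refine h.congr_fun (fun t ht => ?_) measurableSet_Ioo
    have : ((Module.finrank ℝ E : ℝ) - 1 - p) = ((Module.finrank ℝ E - 1 : ℕ) : ℝ) + (-p) := by
      push_cast [hd]
      ring
    simp only [this, smul_eq_mul]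
    rw [Real.rpow_add ht.1, Real.rpow_natCast]
  have hfin := (hasFiniteIntegral_iff_enorm.1 hint.2)
  refine lt_of_le_of_lt (le_of_eq ?_) hfin
  rw [truncNormRpow, lintegral_indicator measurableSet_ball]
  refine setLIntegral_congr_fun_ae measurableSet_ball ?_
  have h0 : ∀ᵐ x ∂μ, x ≠ (0 : E) := by simp [ae_iff]
  filter_upwards [h0] with x hx _
  have hx' : 0 < ‖x‖ := norm_pos_iff.2 hx
  rw [← ofReal_norm, ENNReal.ofReal_rpow_of_pos hx', Real.enorm_of_nonneg (by positivity)]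

lemma ofReal_rpow_neg_le {a x γ : ℝ} (hγ : 0 < γ) (hx : 0 ≤ x) (hax : a ≤ x) :
    ENNReal.ofReal (x ^ (-γ)) ≤ ENNReal.ofReal a ^ (-γ) := by
  rcases hx.eq_or_lt with rfl | hx
  · simp [Real.zero_rpow (neg_ne_zero.2 hγ.ne')]
  · rw [← ENNReal.ofReal_rpow_of_pos hx, ENNReal.rpow_neg, ENNReal.rpow_neg, ENNReal.inv_le_inv]
    gcongr

lemma lintegral_truncNormRpow_fibre_le {n : ℕ} (i : Fin (n + 1)) {γ p R S : ℝ}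
    {b : (Fin n → ℝ) → ℝ} (hb : Measurable b) (y : Fin n → ℝ) :
    ∫⁻ z : EuclideanSpace ℝ (Fin (n + 1)),
        (truncNormRpow γ R (z i - b fun j => z (i.succAbove j)) +
            truncNormRpow γ R (z i + b fun j => z (i.succAbove j))) *
          truncNormRpow p S ((fun j => z (i.succAbove j)) - y) ≤
      (2 * ∫⁻ s : ℝ, truncNormRpow γ R s) * ∫⁻ w : Fin n → ℝ, truncNormRpow p S w := by
  let F : ℝ × (Fin n → ℝ) → ℝ≥0∞ := fun q =>
    (truncNormRpow γ R (q.1 - b q.2) + truncNormRpow γ R (q.1 + b q.2)) *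
      truncNormRpow p S (q.2 - y)
  have hm : ∀ q r, Measurable (truncNormRpow q r : ℝ → ℝ≥0∞) := fun q r =>
    measurable_truncNormRpow q r
  have hm' : ∀ q r, Measurable (truncNormRpow q r : (Fin n → ℝ) → ℝ≥0∞) := fun q r =>
    measurable_truncNormRpow q r
  have hF : Measurable F :=
    (((hm _ _).comp (measurable_fst.sub (hb.comp measurable_snd))).add
      ((hm _ _).comp (measurable_fst.add (hb.comp measurable_snd)))).mul
      ((hm' _ _).comp (measurable_snd.sub_const y))
  have hmp := (volume_preserving_piFinSuccAbove (fun _ : Fin (n + 1) => ℝ) i).comp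
    (PiLp.volume_preserving_ofLp (Fin (n + 1)))
  have h := hmp.lintegral_comp hF
  refine (le_of_eq h).trans ?_
  rw [Measure.volume_eq_prod, lintegral_prod_symm' _ hF]
  have hin : ∀ w : Fin n → ℝ, ∫⁻ s : ℝ, F (s, w) =
      (2 * ∫⁻ s : ℝ, truncNormRpow γ R s) * truncNormRpow p S (w - y) := by
    intro w
    have h1 : Measurable fun s : ℝ => truncNormRpow γ R (s - b w) :=
      (hm _ _).comp (measurable_id.sub_const _)
    have h2 : Measurable fun s : ℝ => truncNormRpow γ R (s + b w) :=
      (hm _ _).comp (measurable_id.add_const _)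
    simp only [F]
    rw [lintegral_mul_const _ (by exact h1.add h2), lintegral_add_left h1,
      lintegral_sub_right_eq_self (truncNormRpow γ R), lintegral_add_right_eq_self
      (truncNormRpow γ R), two_mul]
  simp_rw [hin]
  have h3 : Measurable fun w : Fin n → ℝ => truncNormRpow p S (w - y) :=
    (hm' _ _).comp (measurable_id.sub_const y)
  rw [lintegral_const_mul _ h3,
    lintegral_sub_right_eq_self (truncNormRpow p S)]

/-- A lower bound for `√(s² + a) - 1` in terms of the distance from `|s|` to the root `√(1 - a)`. -/
lemma mul_abs_sub_sqrt_le {c s a r : ℝ} (ha : 0 ≤ a) (hcs : c ≤ |s|) (hr : 1 ≤ r)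
    (hr3 : r < 3) (h : r ^ 2 = s ^ 2 + a) :
    c / 4 * ‖|s| - √(1 - a)‖ ≤ r - 1 ∧ ‖|s| - √(1 - a)‖ < 3 := by
  have hs : |s| ^ 2 = s ^ 2 := sq_abs s
  have hb0 := Real.sqrt_nonneg (1 - a)
  have hb1 : √(1 - a) ≤ 1 := Real.sqrt_le_one.2 (by linarith)
  have key : √(1 - a) ≤ |s| ∧ |s| ^ 2 - √(1 - a) ^ 2 ≤ r ^ 2 - 1 := by
    rcases le_total a 1 with h1 | h1
    · have hb := Real.sq_sqrt (show 0 ≤ 1 - a by linarith)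
      refine ⟨?_, by nlinarith⟩
      apply Real.sqrt_le_left (by positivity) |>.2
      nlinarith
    · rw [Real.sqrt_eq_zero_of_nonpos (by linarith)]
      exact ⟨abs_nonneg s, by nlinarith⟩
  have hs3 : |s| < 3 := abs_lt_of_sq_lt_sq (by nlinarith) (by norm_num)
  rw [Real.norm_eq_abs, abs_of_nonneg (by linarith [key.1])]
  refine ⟨?_, by linarith⟩
  nlinarith [key.1, key.2, mul_nonneg (sub_nonneg.2 key.1) (sub_nonneg.2 hcs),
    mul_nonneg (sub_nonneg.2 key.1) hb0]

lemma exists_one_div_le_abs {m : ℕ} {z : EuclideanSpace ℝ (Fin (m + 1))} (hz : 1 ≤ ‖z‖) :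
    ∃ i, 1 / ((m : ℝ) + 1) ≤ |z i| := by
  by_contra! h
  have hm : (1 : ℝ) ≤ (m : ℝ) + 1 := by simp
  have h1 : ∑ i, z i ^ 2 < ∑ _i : Fin (m + 1), 1 / ((m : ℝ) + 1) := by
    refine Finset.sum_lt_sum_of_nonempty Finset.univ_nonempty fun i _ => ?_
    have hle : 1 / ((m : ℝ) + 1) ≤ 1 := by
      rw [div_le_one (by positivity)]
      exact hm
    rw [← sq_abs]
    nlinarith [h i, abs_nonneg (z i)]
  rw [← EuclideanSpace.real_norm_sq_eq] at h1
  simp at h1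
  have : ((m : ℝ) + 1) * ((m : ℝ) + 1)⁻¹ = 1 := by field_simp
  nlinarith

/-- The kernel `‖x‖ ^ (-d)` beats `‖x‖ ^ (1 - d)`, up to a power of any smaller length. -/
lemma min_rpow_le {d ρ t ε : ℝ} (hε : 0 < ε) (ht : 0 < t) (htρ : t ≤ ρ) :
    min (ρ ^ (-d)) (ρ ^ (-d + 1)) ≤ ρ ^ (-(d - 1 - ε)) * t ^ (-ε) := by
  have hρ : 0 < ρ := ht.trans_le htρ
  refine (min_le_right _ _).trans ?_
  rw [show -d + 1 = -(d - 1 - ε) + -ε by ring, Real.rpow_add hρ]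
  gcongr ?_ * ?_
  exact Real.rpow_le_rpow_of_nonpos ht htρ (by linarith)

section
variable {n : ℕ} {β : ℝ}

lemma norm_succAbove_sub_le (i : Fin (n + 1)) (y z : EuclideanSpace ℝ (Fin (n + 1))) :
    ‖(fun j => z (i.succAbove j)) - fun j => y (i.succAbove j)‖ ≤ ‖y - z‖ := by
  rw [pi_norm_le_iff_of_nonneg (norm_nonneg _)]
  intro j
  rw [norm_sub_rev y z]
  exact PiLp.norm_apply_le (z - y) (i.succAbove j)

lemma ofReal_near_le (hn : 1 ≤ n) (hβ0 : 0 < β) (hβ1 : β < 1) {i : Fin (n + 1)} {c : ℝ}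
    (hc : 0 < c) {y z : EuclideanSpace ℝ (Fin (n + 1))} (hy : ‖y‖ < 1) (hz : 1 ≤ ‖z‖)
    (hz3 : ‖z‖ < 3) (hi : c ≤ |z i|) :
    ENNReal.ofReal ((‖z‖ - 1) ^ (-β) *
        min (‖y - z‖ ^ (-((n + 1 : ℕ) : ℝ))) (‖y - z‖ ^ (-((n + 1 : ℕ) : ℝ) + 1))) ≤
      ENNReal.ofReal (c / 4) ^ (-((1 + β) / 2)) *
        ((truncNormRpow ((1 + β) / 2) 3
              (z i - √(1 - ∑ j, z (i.succAbove j) ^ 2)) +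
            truncNormRpow ((1 + β) / 2) 3
              (z i + √(1 - ∑ j, z (i.succAbove j) ^ 2))) *
          truncNormRpow (n - (1 - β) / 2) 4
            ((fun j => z (i.succAbove j)) - fun j => y (i.succAbove j))) := by
  have hn' : (1 : ℝ) ≤ n := by exact_mod_cast hn
  rcases hz.eq_or_lt with h1 | h1
  · simp [← h1, Real.zero_rpow (neg_ne_zero.2 hβ0.ne')]
  have ht : 0 < ‖z‖ - 1 := by linarith
  have htρ : ‖z‖ - 1 ≤ ‖y - z‖ := by
    have := norm_sub_norm_le z y
    rw [norm_sub_rev] at this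
    linarith
  set a := ∑ j, z (i.succAbove j) ^ 2 with ha
  have ha0 : 0 ≤ a := Finset.sum_nonneg fun j _ => sq_nonneg _
  have hsq : ‖z‖ ^ 2 = z i ^ 2 + a := by
    rw [EuclideanSpace.real_norm_sq_eq, Fin.sum_univ_succAbove _ i]
  obtain ⟨hlow, hlt⟩ := mul_abs_sub_sqrt_le ha0 hi hz hz3 hsq
  have hw := norm_succAbove_sub_le i y z
  have hw4 : ‖(fun j => z (i.succAbove j)) - fun j => y (i.succAbove j)‖ < 4 :=
    hw.trans_lt ((norm_sub_le _ _).trans_lt (by linarith))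
  have hsplit : truncNormRpow ((1 + β) / 2) 3 (|z i| - √(1 - a)) ≤
      truncNormRpow ((1 + β) / 2) 3 (z i - √(1 - a)) +
        truncNormRpow ((1 + β) / 2) 3 (z i + √(1 - a)) := by
    rcases abs_choice (z i) with h | h
    · rw [h]
      exact le_self_add
    · have : truncNormRpow ((1 + β) / 2) 3 (|z i| - √(1 - a)) =
          truncNormRpow ((1 + β) / 2) 3 (z i + √(1 - a)) := by
        rw [h, show -z i - √(1 - a) = -(z i + √(1 - a)) by ring]
        simp only [truncNormRpow, indicator, mem_ball_zero_iff, norm_neg, enorm_neg]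
      rw [this]
      exact le_add_self
  have hmain : (‖z‖ - 1) ^ (-β) *
        min (‖y - z‖ ^ (-((n + 1 : ℕ) : ℝ))) (‖y - z‖ ^ (-((n + 1 : ℕ) : ℝ) + 1)) ≤
      (‖z‖ - 1) ^ (-((1 + β) / 2)) * ‖y - z‖ ^ (-(n - (1 - β) / 2)) := by
    have h := min_rpow_le (d := ((n + 1 : ℕ) : ℝ)) (ε := (1 - β) / 2) (by linarith) ht htρ
    rw [show ((n + 1 : ℕ) : ℝ) - 1 - (1 - β) / 2 = n - (1 - β) / 2 by push_cast; ring] at h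
    refine (mul_le_mul_of_nonneg_left h (by positivity)).trans ?_
    rw [show -((1 + β) / 2) = -β + -((1 - β) / 2) by ring, Real.rpow_add ht]
    exact le_of_eq (by ring)
  calc _ ≤ ENNReal.ofReal
        ((‖z‖ - 1) ^ (-((1 + β) / 2)) * ‖y - z‖ ^ (-(n - (1 - β) / 2))) :=
        ENNReal.ofReal_le_ofReal hmain
    _ = ENNReal.ofReal ((‖z‖ - 1) ^ (-((1 + β) / 2))) *
        ENNReal.ofReal (‖y - z‖ ^ (-(n - (1 - β) / 2))) := ENNReal.ofReal_mul (by positivity)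
    _ ≤ ENNReal.ofReal (c / 4 * ‖|z i| - √(1 - a)‖) ^ (-((1 + β) / 2)) *
        ENNReal.ofReal ‖(fun j => z (i.succAbove j)) - fun j => y (i.succAbove j)‖ ^
          (-(n - (1 - β) / 2)) :=
      mul_le_mul' (ofReal_rpow_neg_le (by linarith) ht.le hlow)
        (ofReal_rpow_neg_le (by linarith) (norm_nonneg _) hw)
    _ = ENNReal.ofReal (c / 4) ^ (-((1 + β) / 2)) *
        (truncNormRpow ((1 + β) / 2) 3 (|z i| - √(1 - a)) *
          truncNormRpow (n - (1 - β) / 2) 4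
            ((fun j => z (i.succAbove j)) - fun j => y (i.succAbove j))) := by
      rw [ENNReal.ofReal_mul (by positivity), ENNReal.mul_rpow_of_ne_top (by simp) (by simp),
        truncNormRpow, truncNormRpow, indicator_of_mem (mem_ball_zero_iff.2 hlt),
        indicator_of_mem (mem_ball_zero_iff.2 hw4), ofReal_norm, ofReal_norm, mul_assoc]
    _ ≤ _ := by gcongr

lemma ofReal_far_le (hβ0 : 0 < β) {y z : EuclideanSpace ℝ (Fin (n + 1))} (hy : ‖y‖ < 1)
    (hz3 : 3 ≤ ‖z‖) :
    ENNReal.ofReal ((‖z‖ - 1) ^ (-β) *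
        min (‖y - z‖ ^ (-((n + 1 : ℕ) : ℝ))) (‖y - z‖ ^ (-((n + 1 : ℕ) : ℝ) + 1))) ≤
      ENNReal.ofReal ((1 / 2) ^ (-(((n + 1 : ℕ) : ℝ) + β))) *
        ENNReal.ofReal ((1 + ‖z‖) ^ (-(((n + 1 : ℕ) : ℝ) + β))) := by
  rw [← ENNReal.ofReal_mul (by positivity)]
  refine ENNReal.ofReal_le_ofReal ?_
  have ht : 0 < ‖z‖ - 1 := by linarith
  have htρ : ‖z‖ - 1 ≤ ‖y - z‖ := by
    have := norm_sub_norm_le z y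
    rw [norm_sub_rev] at this
    linarith
  calc _ ≤ (‖z‖ - 1) ^ (-β) * (‖z‖ - 1) ^ (-((n + 1 : ℕ) : ℝ)) := by
        gcongr
        refine (min_le_left _ _).trans (Real.rpow_le_rpow_of_nonpos ht htρ ?_)
        exact neg_nonpos.2 (Nat.cast_nonneg _)
    _ = (‖z‖ - 1) ^ (-(((n + 1 : ℕ) : ℝ) + β)) := by
        rw [← Real.rpow_add ht]
        ring_nf
    _ ≤ (1 / 2 * (1 + ‖z‖)) ^ (-(((n + 1 : ℕ) : ℝ) + β)) :=
        Real.rpow_le_rpow_of_nonpos (by positivity) (by linarith)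
          (neg_nonpos.2 (by positivity))
    _ = _ := Real.mul_rpow (by norm_num) (by positivity)

lemma exists_setLIntegral_bound (hn : 1 ≤ n) (hβ0 : 0 < β) (hβ1 : β < 1) :
    ∃ B : ℝ≥0∞, B < ∞ ∧ ∀ y ∈ ball (0 : EuclideanSpace ℝ (Fin (n + 1))) 1,
      ∫⁻ z in (ball (0 : EuclideanSpace ℝ (Fin (n + 1))) 1)ᶜ,
        ENNReal.ofReal ((‖z‖ - 1) ^ (-β) *
          min (‖y - z‖ ^ (-((n + 1 : ℕ) : ℝ))) (‖y - z‖ ^ (-((n + 1 : ℕ) : ℝ) + 1))) ≤ B := by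
  have : Nonempty (Fin n) := ⟨⟨0, hn⟩⟩
  let A : ℝ≥0∞ := ENNReal.ofReal (1 / ((n : ℝ) + 1) / 4) ^ (-((1 + β) / 2))
  let H : ℝ≥0∞ := ∫⁻ s : ℝ, truncNormRpow ((1 + β) / 2) 3 s
  let K : ℝ≥0∞ := ∫⁻ w : Fin n → ℝ, truncNormRpow (n - (1 - β) / 2) 4 w
  let D : ℝ≥0∞ := ENNReal.ofReal ((1 / 2) ^ (-(((n + 1 : ℕ) : ℝ) + β)))
  let T : EuclideanSpace ℝ (Fin (n + 1)) → ℝ≥0∞ := fun z =>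
    ENNReal.ofReal ((1 + ‖z‖) ^ (-(((n + 1 : ℕ) : ℝ) + β)))
  have hc : 0 < 1 / ((n : ℝ) + 1) := by positivity
  have hA : A < ∞ :=
    (ENNReal.rpow_ne_top_of_ne_zero (ENNReal.ofReal_pos.2 (by positivity)).ne' (by simp)).lt_top
  have hH : H < ∞ := lintegral_truncNormRpow_lt_top volume (by simp; linarith) (by norm_num)
  have hK : K < ∞ := lintegral_truncNormRpow_lt_top volume (by simp; linarith) (by norm_num)
  have hT : ∫⁻ z, T z < ∞ := finite_integral_one_add_norm (by simp; linarith)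
  refine ⟨(∑ _i : Fin (n + 1), A * (2 * H * K)) + D * ∫⁻ z, T z, ?_, fun y hy => ?_⟩
  · refine ENNReal.add_lt_top.2 ⟨ENNReal.sum_lt_top.2 fun _ _ => ?_,
      ENNReal.mul_lt_top ENNReal.ofReal_lt_top hT⟩
    exact ENNReal.mul_lt_top hA
      (ENNReal.mul_lt_top (ENNReal.mul_lt_top (by simp) hH) hK)
  have hy' : ‖y‖ < 1 := mem_ball_zero_iff.1 hy
  let b : (Fin n → ℝ) → ℝ := fun w => √(1 - ∑ j, w j ^ 2)
  have hb : Measurable b := by fun_prop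
  let G : Fin (n + 1) → EuclideanSpace ℝ (Fin (n + 1)) → ℝ≥0∞ := fun i z =>
    (truncNormRpow ((1 + β) / 2) 3 (z i - b fun j => z (i.succAbove j)) +
        truncNormRpow ((1 + β) / 2) 3 (z i + b fun j => z (i.succAbove j))) *
      truncNormRpow (n - (1 - β) / 2) 4
        ((fun j => z (i.succAbove j)) - fun j => y (i.succAbove j))
  have hTm : Measurable T := by fun_prop
  calc _ ≤ ∫⁻ z in (ball (0 : EuclideanSpace ℝ (Fin (n + 1))) 1)ᶜ,
        ((∑ i, A * G i z) + D * T z) := by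
        refine setLIntegral_mono' measurableSet_ball.compl fun z hz => ?_
        have hz1 : 1 ≤ ‖z‖ := by simpa using hz
        rcases lt_or_ge ‖z‖ 3 with h3 | h3
        · obtain ⟨i, hi⟩ := exists_one_div_le_abs hz1
          exact (ofReal_near_le hn hβ0 hβ1 hc hy' hz1 h3 hi).trans
            ((Finset.single_le_sum (f := fun i => A * G i z) (fun _ _ => zero_le)
              (Finset.mem_univ i)).trans le_self_add)
        · exact (ofReal_far_le hβ0 hy' h3).trans le_add_self
    _ ≤ ∫⁻ z, ((∑ i, A * G i z) + D * T z) := setLIntegral_le_lintegral _ _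
    _ = (∑ i, A * ∫⁻ z, G i z) + D * ∫⁻ z, T z := by
        have hG : ∀ i, Measurable (G i) := by
          intro i
          have h1 : Measurable fun z : EuclideanSpace ℝ (Fin (n + 1)) => z i := by fun_prop
          have h2 : Measurable fun (z : EuclideanSpace ℝ (Fin (n + 1))) (j : Fin n) =>
            z (i.succAbove j) := by fun_prop
          exact (((measurable_truncNormRpow _ _).comp (h1.sub (hb.comp h2))).add
            ((measurable_truncNormRpow _ _).comp (h1.add (hb.comp h2)))).mul
            ((measurable_truncNormRpow _ _).comp (h2.sub_const _))
        rw [lintegral_add_right _ (hTm.const_mul D), lintegral_const_mul _ hTm,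
          lintegral_finsetSum _ fun i _ => (hG i).const_mul A]
        simp_rw [lintegral_const_mul A (hG _)]
    _ ≤ _ := by
        gcongr with i
        exact lintegral_truncNormRpow_fibre_le i hb _

end

/-- There is `C = C(d,α)` such that for every `y ∈ B(0,1)`,
`∫_{ℝ^d \ B(0,1)} (|z|−1)^{-α/2} · min(|y−z|^{-d}, |y−z|^{-d+1}) dz ≤ C`
(the integral being finite). -/
theorem stmt9 (d : ℕ) (hd : 2 ≤ d) (α : ℝ) (hα : α ∈ Set.Ioo (0 : ℝ) 2) :
    ∃ C : ℝ, 0 < C ∧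
      ∀ y ∈ ball (0 : EuclideanSpace ℝ (Fin d)) 1,
        IntegrableOn
          (fun z : EuclideanSpace ℝ (Fin d) =>
            (‖z‖ - 1) ^ (-(α / 2)) *
              min (‖y - z‖ ^ (-(d : ℝ))) (‖y - z‖ ^ (-(d : ℝ) + 1)))
          (ball (0 : EuclideanSpace ℝ (Fin d)) 1)ᶜ ∧
        (∫ z in (ball (0 : EuclideanSpace ℝ (Fin d)) 1)ᶜ,
            (‖z‖ - 1) ^ (-(α / 2)) *
              min (‖y - z‖ ^ (-(d : ℝ))) (‖y - z‖ ^ (-(d : ℝ) + 1))) ≤ C := by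
  obtain ⟨n, rfl⟩ : ∃ n, d = n + 1 := ⟨d - 1, by omega⟩
  obtain ⟨B, hB, hle⟩ := exists_setLIntegral_bound (n := n) (β := α / 2) (by omega)
    (by linarith [hα.1]) (by linarith [hα.2])
  refine ⟨B.toReal + 1, by positivity, fun y hy => ?_⟩
  have hm : AEStronglyMeasurable (fun z : EuclideanSpace ℝ (Fin (n + 1)) =>
      (‖z‖ - 1) ^ (-(α / 2)) *
        min (‖y - z‖ ^ (-((n + 1 : ℕ) : ℝ))) (‖y - z‖ ^ (-((n + 1 : ℕ) : ℝ) + 1)))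
      (volume.restrict (ball (0 : EuclideanSpace ℝ (Fin (n + 1))) 1)ᶜ) :=
    Measurable.aestronglyMeasurable (by fun_prop)
  have h0 : 0 ≤ᵐ[volume.restrict (ball (0 : EuclideanSpace ℝ (Fin (n + 1))) 1)ᶜ]
      fun z : EuclideanSpace ℝ (Fin (n + 1)) => (‖z‖ - 1) ^ (-(α / 2)) *
        min (‖y - z‖ ^ (-((n + 1 : ℕ) : ℝ))) (‖y - z‖ ^ (-((n + 1 : ℕ) : ℝ) + 1)) := by
    refine ae_restrict_of_forall_mem measurableSet_ball.compl fun z hz => ?_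
    have hz1 : 1 ≤ ‖z‖ := by simpa using hz
    exact mul_nonneg (Real.rpow_nonneg (by linarith) _) (le_min (by positivity) (by positivity))
  refine ⟨(lintegral_ofReal_ne_top_iff_integrable hm h0).1 ((hle y hy).trans_lt hB).ne, ?_⟩
  rw [integral_eq_lintegral_of_nonneg_ae h0 hm]
  exact (ENNReal.toReal_mono hB.ne (hle y hy)).trans (by linarith)
end

section
/- For s > 0 define q_s : ℝ^d → [0,∞) by q_s(x) = min(s^{-d/α}, s|x|^{-d-α}). There is a constant C = C(d,α) such that for every s ∈ (0,1) and every y ∈ B(0,1) \ B(0,1/2): ∫_{B(0,1)} q_s(y − v) · min(1, (1 − |v|)^{α/2} s^{-1/2}) · (1 − |v|)^{-α} dv ≤ C / s. -/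
open MeasureTheory Set Metric

/-- The two-sided profile of the heat kernel of the isotropic `α`-stable
process: `q_s(x) = min(s^{-d/α}, s|x|^{-d-α})`. -/
noncomputable def stableProfile (d : ℕ) (α s : ℝ) (x : EuclideanSpace ℝ (Fin d)) : ℝ :=
  min (s ^ (-(d : ℝ) / α)) (s * ‖x‖ ^ (-(d : ℝ) - α))

open scoped ENNReal

/-- The power `t ^ (-β)` on the positive half-line, extended by zero. -/
noncomputable def truncatedPower (β : ℝ) : ℝ → ℝ≥0∞ :=
  (Ioi (0 : ℝ)).indicator fun t => ENNReal.ofReal (t ^ (-β))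

lemma measurable_truncatedPower (β : ℝ) : Measurable (truncatedPower β) :=
  Measurable.indicator (by fun_prop) measurableSet_Ioi

lemma truncatedPower_of_pos (β : ℝ) {t : ℝ} (ht : 0 < t) :
    truncatedPower β t = ENNReal.ofReal (t ^ (-β)) :=
  indicator_of_mem (mem_Ioi.2 ht) _

lemma truncatedPower_le_of_le {β : ℝ} (hβ : 0 ≤ β) {t u : ℝ} (ht : 0 < t) (htu : t ≤ u) :
    truncatedPower β u ≤ truncatedPower β t := by
  rw [truncatedPower_of_pos β ht, truncatedPower_of_pos β (ht.trans_le htu)]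
  exact ENNReal.ofReal_le_ofReal (Real.rpow_le_rpow_of_nonpos ht htu (by linarith))

lemma lintegral_Ioc_rpow_neg {β : ℝ} (hβ : β < 1) {r : ℝ} (hr : 0 < r) :
    ∫⁻ t in Ioc 0 r, ENNReal.ofReal (t ^ (-β)) = ENNReal.ofReal (r ^ (1 - β) / (1 - β)) := by
  have hint : IntegrableOn (fun t : ℝ => t ^ (-β)) (Ioc 0 r) := by
    have := intervalIntegral.intervalIntegrable_rpow' (a := 0) (b := r) (r := -β) (by linarith)
    rwa [intervalIntegrable_iff, uIoc_of_le hr.le] at this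
  rw [← ofReal_integral_eq_lintegral_ofReal hint, ← intervalIntegral.integral_of_le hr.le,
    integral_rpow (Or.inl (by linarith)), neg_add_eq_sub, Real.zero_rpow (by linarith), sub_zero]
  filter_upwards [ae_restrict_mem measurableSet_Ioc] with t ht
  exact Real.rpow_nonneg ht.1.le _

/-- The average of a translated truncated power over an interval of length `r` is at most
a constant multiple of `r ^ (-β)`. -/
lemma lintegral_Ioo_truncatedPower_le {β : ℝ} (hβ₀ : 0 ≤ β) (hβ : β < 1) {r : ℝ} (hr : 0 < r)
    (a b : ℝ) :
    ∫⁻ t in Ioo (b - r) b, truncatedPower β (t - a) ≤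
      ENNReal.ofReal (r ^ (1 - β) * (1 + 1 / (1 - β))) := by
  set ψ : ℝ → ℝ≥0∞ := (Ioc 0 r).indicator fun t => ENNReal.ofReal (t ^ (-β)) with hψ
  have hψm : Measurable ψ := Measurable.indicator (by fun_prop) measurableSet_Ioc
  have hle : ∀ t, truncatedPower β t ≤ ENNReal.ofReal (r ^ (-β)) + ψ t := by
    intro t
    rcases le_or_gt t 0 with h0 | h0
    · simp [truncatedPower, h0]
    rcases le_or_gt t r with h1 | h1
    · rw [hψ, truncatedPower_of_pos β h0, indicator_of_mem (show t ∈ Ioc 0 r from ⟨h0, h1⟩)]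
      exact le_add_self
    · refine (truncatedPower_le_of_le hβ₀ hr h1.le).trans ?_
      rw [truncatedPower_of_pos β hr]
      exact le_self_add
  calc ∫⁻ t in Ioo (b - r) b, truncatedPower β (t - a)
      ≤ ∫⁻ t in Ioo (b - r) b, (ENNReal.ofReal (r ^ (-β)) + ψ (t - a)) :=
        lintegral_mono fun t => hle _
    _ = ENNReal.ofReal (r ^ (-β)) * ENNReal.ofReal r + ∫⁻ t in Ioo (b - r) b, ψ (t - a) := by
        rw [lintegral_add_left measurable_const, setLIntegral_const, Real.volume_Ioo,
          sub_sub_cancel]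
    _ ≤ ENNReal.ofReal (r ^ (-β)) * ENNReal.ofReal r + ∫⁻ t, ψ (t - a) := by
        gcongr
        exact Measure.restrict_le_self
    _ = ENNReal.ofReal (r ^ (-β)) * ENNReal.ofReal r +
          ENNReal.ofReal (r ^ (1 - β) / (1 - β)) := by
        rw [lintegral_sub_right_eq_self ψ a, hψ, lintegral_indicator measurableSet_Ioc,
          lintegral_Ioc_rpow_neg hβ hr]
    _ = ENNReal.ofReal (r ^ (1 - β) * (1 + 1 / (1 - β))) := by
        have h1 : (0 : ℝ) < 1 - β := by linarith
        rw [← ENNReal.ofReal_mul (by positivity), ← ENNReal.ofReal_add (by positivity)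
          (by positivity)]
        congr 1
        rw [show (1 : ℝ) - β = -β + 1 by ring, Real.rpow_add_one hr.ne']
        ring

section Scaling

variable {E : Type*} [NormedAddCommGroup E] [NormedSpace ℝ E] [FiniteDimensional ℝ E]
  [MeasurableSpace E] [BorelSpace E] (μ : Measure E) [μ.IsAddHaarMeasure]

lemma lintegral_comp_smul_addHaar (f : E → ℝ≥0∞) {c : ℝ} (hc : 0 < c) :
    ∫⁻ x, f (c • x) ∂μ = ENNReal.ofReal ((c ^ Module.finrank ℝ E)⁻¹) * ∫⁻ x, f x ∂μ := by
  have h := (Homeomorph.smulOfNeZero c hc.ne' : E ≃ₜ E).measurableEmbedding.lintegral_map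
    (μ := μ) f
  have h' := Measure.map_addHaar_smul μ hc.ne'
  rw [abs_of_pos (by positivity)] at h'
  simp only [Homeomorph.smulOfNeZero_apply] at h
  rw [← h]
  change ∫⁻ x, f x ∂(Measure.map (c • ·) μ) = _
  rw [h', lintegral_smul_measure, smul_eq_mul]

/-- If `h` varies by at most a factor `K` on the scale `r`, then the integral of `h` against
the weight `(1 - ‖v‖) ^ (-β)` on the unit ball is controlled by `r ^ (-β)` times the total
integral of `h`. This follows by averaging over the dilations `v ↦ t • v`, `1 - r < t < 1`. -/
lemma setLIntegral_ball_mul_one_sub_norm_rpow_le {β : ℝ} (hβ₀ : 0 ≤ β) (hβ : β < 1)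
    {r : ℝ} (hr : 0 < r) (hr2 : r ≤ 1 / 2) {h : E → ℝ≥0∞} (hm : Measurable h) {K : ℝ≥0∞}
    (hK : ∀ x x', ‖x - x'‖ ≤ r → h x ≤ K * h x') :
    ∫⁻ v in ball (0 : E) 1, h v * ENNReal.ofReal ((1 - ‖v‖) ^ (-β)) ∂μ ≤
      K * ENNReal.ofReal (2 ^ Module.finrank ℝ E * (r ^ (-β) * (1 + 1 / (1 - β)))) *
        ∫⁻ x, h x ∂μ := by
  set n := Module.finrank ℝ E
  set I := ∫⁻ v in ball (0 : E) 1, h v * ENNReal.ofReal ((1 - ‖v‖) ^ (-β)) ∂μ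
  have hφ := measurable_truncatedPower β
  have hdil : ∀ t ∈ Ioo (1 - r) 1, I ≤ K * ENNReal.ofReal (2 ^ n) *
      ∫⁻ u, h u * truncatedPower β (t - ‖u‖) ∂μ := by
    intro t ht
    have ht0 : 0 < t := by linarith [ht.1]
    have hpt : ∀ v ∈ ball (0 : E) 1, h v * ENNReal.ofReal ((1 - ‖v‖) ^ (-β)) ≤
        K * (h (t • v) * truncatedPower β (t - ‖t • v‖)) := by
      intro v hv
      have hv1 : ‖v‖ < 1 := by simpa using hv
      have hnorm : ‖v - t • v‖ ≤ r := by
        have : v - t • v = (1 - t) • v := by rw [sub_smul, one_smul]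
        rw [this, norm_smul, Real.norm_of_nonneg (by linarith [ht.2])]
        nlinarith [norm_nonneg v, ht.1, ht.2]
      have hpos : 0 < t - ‖t • v‖ := by
        rw [norm_smul, Real.norm_of_nonneg ht0.le]
        nlinarith
      have hle : t - ‖t • v‖ ≤ 1 - ‖v‖ := by
        rw [norm_smul, Real.norm_of_nonneg ht0.le]
        nlinarith [ht.2]
      rw [← truncatedPower_of_pos β (by linarith), ← mul_assoc]
      exact mul_le_mul' (hK _ _ hnorm) (truncatedPower_le_of_le hβ₀ hpos hle)
    calc I ≤ ∫⁻ v in ball (0 : E) 1, K * (h (t • v) * truncatedPower β (t - ‖t • v‖)) ∂μ :=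
          setLIntegral_mono' measurableSet_ball hpt
      _ ≤ ∫⁻ v, K * (h (t • v) * truncatedPower β (t - ‖t • v‖)) ∂μ :=
          setLIntegral_le_lintegral _ _
      _ = K * (ENNReal.ofReal ((t ^ n)⁻¹) * ∫⁻ u, h u * truncatedPower β (t - ‖u‖) ∂μ) := by
          rw [lintegral_const_mul _ (by fun_prop),
            lintegral_comp_smul_addHaar μ (fun u => h u * truncatedPower β (t - ‖u‖)) ht0]
      _ ≤ K * (ENNReal.ofReal (2 ^ n) * ∫⁻ u, h u * truncatedPower β (t - ‖u‖) ∂μ) := by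
          gcongr
          rw [← inv_pow]
          gcongr
          rw [inv_le_comm₀ ht0 two_pos]
          linarith [ht.1]
      _ = _ := by rw [mul_assoc]
  have hswap : ∫⁻ t in Ioo (1 - r) 1, ∫⁻ u, h u * truncatedPower β (t - ‖u‖) ∂μ ≤
      ENNReal.ofReal (r ^ (1 - β) * (1 + 1 / (1 - β))) * ∫⁻ u, h u ∂μ := by
    rw [lintegral_lintegral_swap (by unfold Function.uncurry; fun_prop),
      ← lintegral_const_mul _ hm]
    refine lintegral_mono fun u => ?_
    rw [lintegral_const_mul _ (by fun_prop), mul_comm]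
    gcongr
    exact lintegral_Ioo_truncatedPower_le hβ₀ hβ hr _ _
  have havg : ENNReal.ofReal r * I ≤ K * ENNReal.ofReal (2 ^ n) *
      (ENNReal.ofReal (r ^ (1 - β) * (1 + 1 / (1 - β))) * ∫⁻ u, h u ∂μ) := by
    calc ENNReal.ofReal r * I = ∫⁻ _ in Ioo (1 - r) 1, I := by
          rw [setLIntegral_const, Real.volume_Ioo, sub_sub_cancel, mul_comm]
      _ ≤ ∫⁻ t in Ioo (1 - r) 1, K * ENNReal.ofReal (2 ^ n) *
            ∫⁻ u, h u * truncatedPower β (t - ‖u‖) ∂μ :=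
          setLIntegral_mono' measurableSet_Ioo hdil
      _ = K * ENNReal.ofReal (2 ^ n) *
            ∫⁻ t in Ioo (1 - r) 1, ∫⁻ u, h u * truncatedPower β (t - ‖u‖) ∂μ := by
          rw [lintegral_const_mul]
          exact Measurable.lintegral_prod_right (by fun_prop)
      _ ≤ _ := by gcongr
  have hr0 : ENNReal.ofReal r ≠ 0 := by simpa using hr
  rw [← ENNReal.mul_le_mul_iff_right hr0 ENNReal.ofReal_ne_top]
  refine havg.trans_eq ?_
  have h1 : (0 : ℝ) < 1 - β := by linarith
  have hsplit : ENNReal.ofReal (r ^ (1 - β) * (1 + 1 / (1 - β))) =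
      ENNReal.ofReal r * ENNReal.ofReal (r ^ (-β) * (1 + 1 / (1 - β))) := by
    rw [← ENNReal.ofReal_mul hr.le, show (1 : ℝ) - β = -β + 1 by ring,
      Real.rpow_add_one hr.ne']
    congr 1
    ring
  rw [hsplit, ENNReal.ofReal_mul (p := 2 ^ n) (by positivity)]
  ring

end Scaling

/-- A strictly positive kernel comparable to the stable profile at the spatial scale `R`. -/
noncomputable def smoothProfile (d : ℕ) (α R : ℝ) (x : EuclideanSpace ℝ (Fin d)) : ℝ :=
  R ^ (-(d : ℝ)) * (1 + ‖R⁻¹ • x‖) ^ (-((d : ℝ) + α))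

lemma measurable_smoothProfile (d : ℕ) (α R : ℝ) : Measurable (smoothProfile d α R) := by
  unfold smoothProfile
  fun_prop

lemma smoothProfile_nonneg (d : ℕ) (α : ℝ) {R : ℝ} (hR : 0 < R) (x : EuclideanSpace ℝ (Fin d)) :
    0 ≤ smoothProfile d α R x := by
  unfold smoothProfile
  positivity

lemma stableProfile_le_smoothProfile (d : ℕ) {α R : ℝ} (hα : 0 < α) (hR : 0 < R)
    (x : EuclideanSpace ℝ (Fin d)) :
    stableProfile d α (R ^ α) x ≤ 2 ^ ((d : ℝ) + α) * smoothProfile d α R x := by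
  have hN : (0 : ℝ) < d + α := by positivity
  have hnorm : ‖R⁻¹ • x‖ = ‖x‖ / R := by
    rw [norm_smul, Real.norm_of_nonneg (by positivity), div_eq_inv_mul]
  have hhalf : 2 ^ ((d : ℝ) + α) * (1 + ‖x‖ / R) ^ (-((d : ℝ) + α)) =
      ((1 + ‖x‖ / R) / 2) ^ (-((d : ℝ) + α)) := by
    rw [Real.div_rpow (by positivity) zero_le_two, Real.rpow_neg zero_le_two (_ + _), div_inv_eq_mul,
      mul_comm]
  have hrw : 2 ^ ((d : ℝ) + α) * smoothProfile d α R x =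
      R ^ (-(d : ℝ)) * ((1 + ‖x‖ / R) / 2) ^ (-((d : ℝ) + α)) := by
    rw [← hhalf, smoothProfile, hnorm]
    ring
  rw [hrw]
  rcases le_or_gt ‖x‖ R with hx | hx
  · have hx1 : ‖x‖ / R ≤ 1 := (div_le_one hR).2 hx
    refine (min_le_left _ _).trans ?_
    rw [← Real.rpow_mul hR.le, mul_div_cancel₀ _ hα.ne']
    refine le_mul_of_one_le_right (by positivity) ?_
    exact Real.one_le_rpow_of_pos_of_le_one_of_nonpos (by positivity) (by linarith) (by linarith)
  · have hx1 : 1 ≤ ‖x‖ / R := (one_le_div hR).2 hx.le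
    have hx0 : 0 < ‖x‖ := hR.trans hx
    refine (min_le_right _ _).trans ?_
    have heq : R ^ α * ‖x‖ ^ (-(d : ℝ) - α) = R ^ (-(d : ℝ)) * (‖x‖ / R) ^ (-((d : ℝ) + α)) := by
      rw [Real.div_rpow hx0.le hR.le, ← neg_add', show -(d : ℝ) = -((d : ℝ) + α) + α by ring,
        Real.rpow_add hR]
      field_simp
    rw [heq]
    gcongr R ^ (-(d : ℝ)) * ?_
    exact Real.rpow_le_rpow_of_nonpos (by positivity) (by linarith) (by linarith)

lemma smoothProfile_le_of_norm_sub_le (d : ℕ) {α R : ℝ} (hα : 0 < α) (hR : 0 < R)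
    {x x' : EuclideanSpace ℝ (Fin d)} (hx : ‖x - x'‖ ≤ R) :
    smoothProfile d α R x ≤ 2 ^ ((d : ℝ) + α) * smoothProfile d α R x' := by
  have hN : (0 : ℝ) < d + α := by positivity
  have hhalf : 2 ^ ((d : ℝ) + α) * (1 + ‖R⁻¹ • x'‖) ^ (-((d : ℝ) + α)) =
      ((1 + ‖R⁻¹ • x'‖) / 2) ^ (-((d : ℝ) + α)) := by
    rw [Real.div_rpow (by positivity) zero_le_two, Real.rpow_neg zero_le_two (_ + _), div_inv_eq_mul,
      mul_comm]
  have hdist : ‖R⁻¹ • x'‖ ≤ ‖R⁻¹ • x‖ + 1 := by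
    have h1 : ‖R⁻¹ • (x - x')‖ ≤ 1 := by
      rw [norm_smul, Real.norm_of_nonneg (by positivity), ← div_eq_inv_mul]
      exact (div_le_one hR).2 hx
    have h2 := norm_sub_norm_le (R⁻¹ • x') (R⁻¹ • x)
    rw [norm_sub_rev, ← smul_sub] at h2
    linarith
  unfold smoothProfile
  rw [mul_left_comm, hhalf]
  gcongr R ^ (-(d : ℝ)) * ?_
  refine Real.rpow_le_rpow_of_nonpos (by positivity) ?_ (by linarith)
  linarith [norm_nonneg (R⁻¹ • x)]

lemma lintegral_smoothProfile_sub (d : ℕ) (α : ℝ) {R : ℝ} (hR : 0 < R)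
    (y : EuclideanSpace ℝ (Fin d)) :
    ∫⁻ v, ENNReal.ofReal (smoothProfile d α R (y - v)) =
      ∫⁻ x : EuclideanSpace ℝ (Fin d), ENNReal.ofReal ((1 + ‖x‖) ^ (-((d : ℝ) + α))) := by
  rw [lintegral_sub_left_eq_self (fun x => ENNReal.ofReal (smoothProfile d α R x)) y]
  have h1 : ∀ x : EuclideanSpace ℝ (Fin d), ENNReal.ofReal (smoothProfile d α R x) =
      ENNReal.ofReal (R ^ (-(d : ℝ))) *
        ENNReal.ofReal ((1 + ‖R⁻¹ • x‖) ^ (-((d : ℝ) + α))) := fun x => by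
    rw [smoothProfile, ENNReal.ofReal_mul (by positivity)]
  simp_rw [h1]
  rw [lintegral_const_mul _ (by fun_prop), lintegral_comp_smul_addHaar volume
    (fun x : EuclideanSpace ℝ (Fin d) => ENNReal.ofReal ((1 + ‖x‖) ^ (-((d : ℝ) + α))))
    (inv_pos.2 hR), ← mul_assoc, ← ENNReal.ofReal_mul (by positivity), finrank_euclideanSpace_fin,
    inv_pow, inv_inv, Real.rpow_neg hR.le, Real.rpow_natCast, inv_mul_cancel₀ (by positivity),
    ENNReal.ofReal_one, one_mul]

/-- There is `C = C(d,α)` such that for every `s ∈ (0,1)` and every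
`y ∈ B(0,1) \ B(0,1/2)`,
`∫_{B(0,1)} q_s(y−v) · min(1, (1−|v|)^{α/2} s^{-1/2}) · (1−|v|)^{-α} dv ≤ C/s`. -/
theorem stmt10 (d : ℕ) (hd : 2 ≤ d) (α : ℝ) (hα : α ∈ Set.Ioo (0 : ℝ) 2) :
    ∃ C : ℝ, 0 < C ∧
      ∀ s ∈ Set.Ioo (0 : ℝ) 1,
      ∀ y ∈ ball (0 : EuclideanSpace ℝ (Fin d)) 1 \ ball (0 : EuclideanSpace ℝ (Fin d)) (1 / 2),
        IntegrableOn
          (fun v : EuclideanSpace ℝ (Fin d) =>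
            stableProfile d α s (y - v) *
              min 1 ((1 - ‖v‖) ^ (α / 2) * s ^ (-(1 : ℝ) / 2)) *
              (1 - ‖v‖) ^ (-α))
          (ball (0 : EuclideanSpace ℝ (Fin d)) 1) ∧
        (∫ v in ball (0 : EuclideanSpace ℝ (Fin d)) 1,
            stableProfile d α s (y - v) *
              min 1 ((1 - ‖v‖) ^ (α / 2) * s ^ (-(1 : ℝ) / 2)) *
              (1 - ‖v‖) ^ (-α)) ≤ C / s := by
  obtain ⟨hα0, hα2⟩ := hα
  set N : ℝ := d + α with hN
  have hJ := finite_integral_one_add_norm (E := EuclideanSpace ℝ (Fin d)) (μ := volume) (r := N)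
    (by rw [finrank_euclideanSpace_fin]; linarith)
  set J := ∫⁻ x : EuclideanSpace ℝ (Fin d), ENNReal.ofReal ((1 + ‖x‖) ^ (-N)) with hJdef
  set A : ℝ := 2 ^ N * (2 ^ N * (2 ^ d * (2 ^ (α / 2) * (1 + 1 / (1 - α / 2))))) with hA
  have hβ1 : 0 < 1 - α / 2 := by linarith
  have hA0 : 0 < A := by positivity
  refine ⟨A * J.toReal + 1, by positivity, ?_⟩
  rintro s ⟨hs0, hs1⟩ y -
  set R : ℝ := s ^ (1 / α) with hR
  have hR0 : 0 < R := by positivity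
  have hR1 : R ≤ 1 := Real.rpow_le_one hs0.le hs1.le (by positivity)
  have hRs : R ^ α = s := by
    rw [hR, ← Real.rpow_mul hs0.le, one_div_mul_cancel hα0.ne', Real.rpow_one]
  set F : EuclideanSpace ℝ (Fin d) → ℝ := fun v => stableProfile d α s (y - v) *
    min 1 ((1 - ‖v‖) ^ (α / 2) * s ^ (-(1 : ℝ) / 2)) * (1 - ‖v‖) ^ (-α) with hF
  have hFm : Measurable F := by
    simp only [hF, stableProfile]
    fun_prop
  have hF0 : ∀ v ∈ ball (0 : EuclideanSpace ℝ (Fin d)) 1, 0 ≤ F v := by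
    intro v hv
    have hv1 : 0 < 1 - ‖v‖ := by simpa using hv
    simp only [hF, stableProfile]
    positivity
  have hFle : ∀ v ∈ ball (0 : EuclideanSpace ℝ (Fin d)) 1, ENNReal.ofReal (F v) ≤
      ENNReal.ofReal (2 ^ N * s ^ (-(1 : ℝ) / 2)) *
        (ENNReal.ofReal (smoothProfile d α R (y - v)) *
          ENNReal.ofReal ((1 - ‖v‖) ^ (-(α / 2)))) := by
    intro v hv
    have hv1 : 0 < 1 - ‖v‖ := by simpa using hv
    have hsm := smoothProfile_nonneg d α hR0 (y - v)
    have hq := stableProfile_le_smoothProfile d hα0 hR0 (y - v)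
    rw [hRs] at hq
    rw [← ENNReal.ofReal_mul hsm, ← ENNReal.ofReal_mul (by positivity)]
    refine ENNReal.ofReal_le_ofReal ?_
    calc F v ≤ (2 ^ N * smoothProfile d α R (y - v)) *
          ((1 - ‖v‖) ^ (α / 2) * s ^ (-(1 : ℝ) / 2)) * (1 - ‖v‖) ^ (-α) := by
          simp only [hF]
          gcongr
          exact min_le_right _ _
      _ = _ := by
          rw [show -(α / 2) = α / 2 + -α by ring, Real.rpow_add hv1]
          ring
  have hbound : ∫⁻ v in ball (0 : EuclideanSpace ℝ (Fin d)) 1, ENNReal.ofReal (F v) ≤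
      ENNReal.ofReal (A / s) * J := by
    have hgm : Measurable fun v => ENNReal.ofReal (smoothProfile d α R (y - v)) :=
      ((measurable_smoothProfile d α R).comp (by fun_prop)).ennreal_ofReal
    have hkey := setLIntegral_ball_mul_one_sub_norm_rpow_le
      (volume : Measure (EuclideanSpace ℝ (Fin d))) (β := α / 2)
      (by linarith) (by linarith) (r := R / 2) (by linarith) (by linarith) hgm
      (K := ENNReal.ofReal (2 ^ N)) (by
        intro x x' hx
        rw [← ENNReal.ofReal_mul (by positivity)]
        refine ENNReal.ofReal_le_ofReal (smoothProfile_le_of_norm_sub_le d hα0 hR0 ?_)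
        rw [sub_sub_sub_cancel_left, norm_sub_rev]
        linarith)
    rw [lintegral_smoothProfile_sub d α hR0 y, finrank_euclideanSpace_fin] at hkey
    have hpow : (R / 2) ^ (-(α / 2)) = 2 ^ (α / 2) * s ^ (-(1 : ℝ) / 2) := by
      rw [Real.div_rpow hR0.le zero_le_two, Real.rpow_neg zero_le_two, div_inv_eq_mul, mul_comm,
        ← hRs, ← Real.rpow_mul hR0.le]
      congr 2
      ring
    have hss : s ^ (-(1 : ℝ) / 2) * s ^ (-(1 : ℝ) / 2) = s⁻¹ := by
      rw [← Real.rpow_add hs0, ← Real.rpow_neg_one]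
      norm_num
    calc ∫⁻ v in ball (0 : EuclideanSpace ℝ (Fin d)) 1, ENNReal.ofReal (F v)
        ≤ ∫⁻ v in ball (0 : EuclideanSpace ℝ (Fin d)) 1,
            ENNReal.ofReal (2 ^ N * s ^ (-(1 : ℝ) / 2)) *
            (ENNReal.ofReal (smoothProfile d α R (y - v)) *
            ENNReal.ofReal ((1 - ‖v‖) ^ (-(α / 2)))) :=
          setLIntegral_mono' measurableSet_ball hFle
      _ = ENNReal.ofReal (2 ^ N * s ^ (-(1 : ℝ) / 2)) *
            ∫⁻ v in ball (0 : EuclideanSpace ℝ (Fin d)) 1,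
            (ENNReal.ofReal (smoothProfile d α R (y - v)) *
            ENNReal.ofReal ((1 - ‖v‖) ^ (-(α / 2)))) :=
          lintegral_const_mul _ (hgm.mul (by fun_prop))
      _ ≤ ENNReal.ofReal (2 ^ N * s ^ (-(1 : ℝ) / 2)) * _ :=
          mul_le_mul_right hkey _
      _ = ENNReal.ofReal (A / s) * J := by
          rw [← ENNReal.ofReal_mul (by positivity), ← mul_assoc, ← ENNReal.ofReal_mul (by positivity),
            hpow, div_eq_mul_inv A s, ← hss, hA]
          congr 2
          ring
  have hae : 0 ≤ᵐ[volume.restrict (ball (0 : EuclideanSpace ℝ (Fin d)) 1)] F := by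
    filter_upwards [ae_restrict_mem measurableSet_ball] with v hv using hF0 v hv
  have hint : IntegrableOn F (ball (0 : EuclideanSpace ℝ (Fin d)) 1) := by
    refine ⟨hFm.aestronglyMeasurable, ?_⟩
    rw [hasFiniteIntegral_iff_ofReal hae]
    exact hbound.trans_lt (ENNReal.mul_lt_top ENNReal.ofReal_lt_top hJ)
  refine ⟨hint, ?_⟩
  have hreal : ∫ v in ball (0 : EuclideanSpace ℝ (Fin d)) 1, F v ≤ A / s * J.toReal := by
    rw [← ofReal_integral_eq_lintegral_ofReal hint hae, ← ENNReal.ofReal_toReal hJ.ne,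
      ← ENNReal.ofReal_mul (by positivity)] at hbound
    exact (ENNReal.ofReal_le_ofReal_iff (by positivity)).1 hbound
  refine hreal.trans ?_
  rw [div_mul_eq_mul_div]
  gcongr
  linarith
end

section
/- There is a constant C = C(d,α) such that for every Q ∈ ℝ^d with |Q| = 1 and every r ∈ (0,1]: ∫_{B(0,1) ∩ B(Q,r)} (1 − |v|)^{-α/2} dv ≤ C r^{d − α/2}. -/
open MeasureTheory Set Metric

/-- Integrating `(l - a)₊ ^ (-b)` over an interval of length `L` ending at `1` gives at most
`L ^ (1 - b) / (1 - b)`, wherever the singularity `a` lies. -/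
lemma lintegral_indicator_sub_rpow_neg_le {a b L : ℝ} (hb0 : 0 ≤ b) (hb1 : b < 1) :
    ∫⁻ l in Ioo (1 - L) 1, (Ioi a).indicator (fun l => ENNReal.ofReal ((l - a) ^ (-b))) l
      ≤ ENNReal.ofReal (L ^ (1 - b) / (1 - b)) := by
  have h1b : 0 < 1 - b := by linarith
  set m := max a (1 - L) with hm
  have ham : a ≤ m := le_max_left _ _
  have hLm : 1 - L ≤ m := le_max_right _ _
  -- move the singularity to `m`
  have hshift : ∀ l ∈ Ioo (1 - L) 1, l ∈ Ioi a → l ≠ m →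
      l ∈ Ioo m 1 ∧ (l - a) ^ (-b) ≤ (l - m) ^ (-b) := by
    intro l hl hla hlm
    have hml : m < l := lt_of_le_of_ne (max_le (le_of_lt hla) hl.1.le) hlm.symm
    exact ⟨⟨hml, hl.2⟩, Real.rpow_le_rpow_of_nonpos (by linarith) (by linarith) (by linarith)⟩
  have hle : ∫⁻ l in Ioo (1 - L) 1,
        (Ioi a).indicator (fun l => ENNReal.ofReal ((l - a) ^ (-b))) l
      ≤ ∫⁻ l in Ioo m 1, ENNReal.ofReal ((l - m) ^ (-b)) := by
    rw [← lintegral_indicator measurableSet_Ioo, ← lintegral_indicator measurableSet_Ioo]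
    refine lintegral_mono_ae ?_
    have hae : ∀ᵐ l : ℝ, l ≠ m := by simp [ae_iff]
    filter_upwards [hae] with l hlm
    by_cases hl : l ∈ Ioo (1 - L) 1
    · by_cases hla : l ∈ Ioi a
      · obtain ⟨hl', hle⟩ := hshift l hl hla hlm
        rw [indicator_of_mem hl, indicator_of_mem hla, indicator_of_mem hl']
        exact ENNReal.ofReal_le_ofReal hle
      · rw [indicator_of_mem hl, indicator_of_notMem hla]
        exact zero_le
    · rw [indicator_of_notMem hl]
      exact zero_le
  refine hle.trans ?_
  rcases le_or_gt 1 m with hm1 | hm1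
  · simp [Ioo_eq_empty (not_lt.mpr hm1)]
  have hint : IntervalIntegrable (fun l : ℝ => (l - m) ^ (-b)) volume m 1 := by
    have := (intervalIntegral.intervalIntegrable_rpow' (a := 0) (b := 1 - m) (r := -b)
      (by linarith)).comp_sub_right m
    simpa using this
  have hval : ∫ l in m..1, (l - m) ^ (-b) = (1 - m) ^ (1 - b) / (1 - b) := by
    rw [intervalIntegral.integral_comp_sub_right (fun x : ℝ => x ^ (-b)) m, sub_self,
      integral_rpow (Or.inl (by linarith)), show -b + 1 = 1 - b by ring,
      Real.zero_rpow h1b.ne', sub_zero]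
  rw [intervalIntegrable_iff_integrableOn_Ioo_of_le hm1.le] at hint
  rw [← ofReal_integral_eq_lintegral_ofReal hint]
  · rw [← integral_Ioc_eq_integral_Ioo, ← intervalIntegral.integral_of_le hm1.le, hval]
    gcongr
    linarith
  · filter_upwards [ae_restrict_mem measurableSet_Ioo] with l hl
    exact Real.rpow_nonneg (by linarith [hl.1]) _

/-- A set integral over a set `E` that a dilation `l • ·` with `l ≥ 1 / 2` maps into `B` is
controlled by a set integral over `B`. -/
lemma setLIntegral_le_of_smul_mapsTo {d : ℕ} {E B : Set (EuclideanSpace ℝ (Fin d))}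
    (hE : MeasurableSet E) (hB : MeasurableSet B) {l : ℝ} (hl : 1 / 2 ≤ l)
    (hEB : MapsTo (l • ·) E B) {f g : EuclideanSpace ℝ (Fin d) → ENNReal}
    (hg : Measurable g) (hfg : ∀ v ∈ E, f v ≤ g (l • v)) :
    ∫⁻ v in E, f v ≤ 2 ^ d * ∫⁻ w in B, g w := by
  have hl0 : 0 < l := by linarith
  have hle : ∫⁻ v in E, f v ≤ ∫⁻ v, B.indicator g (l • v) := by
    rw [← lintegral_indicator hE]
    refine lintegral_mono fun v => ?_
    by_cases hv : v ∈ E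
    · rw [indicator_of_mem hv, indicator_of_mem (hEB hv)]
      exact hfg v hv
    · rw [indicator_of_notMem hv]
      exact zero_le
  refine hle.trans ?_
  rw [← lintegral_map (g := fun v => l • v) (hg.indicator hB) (measurable_const_smul l),
    Measure.map_addHaar_smul _ hl0.ne', lintegral_smul_measure, lintegral_indicator hB,
    finrank_euclideanSpace_fin, smul_eq_mul]
  gcongr
  rw [show (2 : ENNReal) ^ d = ENNReal.ofReal (2 ^ d) by
    rw [ENNReal.ofReal_pow (by norm_num)]; simp]
  apply ENNReal.ofReal_le_ofReal
  rw [abs_of_pos (by positivity), ← inv_pow]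
  gcongr
  exact inv_le_of_inv_le₀ (by norm_num) (by linarith)

/-- The boundary singularity is integrable near `Q`: average over the dilations by
`l ∈ (1 - r / 2, 1)` and exchange the order of integration. -/
lemma lintegral_ball_inter_ball_le {d : ℕ} {b : ℝ} (hb0 : 0 ≤ b) (hb1 : b < 1)
    {Q : EuclideanSpace ℝ (Fin d)} {r : ℝ} (hr0 : 0 < r) (hr1 : r ≤ 1) :
    ENNReal.ofReal (r / 2) *
        ∫⁻ v in ball (0 : EuclideanSpace ℝ (Fin d)) 1 ∩ ball Q r,
          ENNReal.ofReal ((1 - ‖v‖) ^ (-b))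
      ≤ 2 ^ d * (ENNReal.ofReal ((r / 2) ^ (1 - b) / (1 - b)) * volume (ball Q (2 * r))) := by
  set E := ball (0 : EuclideanSpace ℝ (Fin d)) 1 ∩ ball Q r
  set B := ball Q (2 * r)
  let G : ℝ → EuclideanSpace ℝ (Fin d) → ENNReal := fun l w =>
    (Ioi ‖w‖).indicator (fun l => ENNReal.ofReal ((l - ‖w‖) ^ (-b))) l
  have hG : Measurable (Function.uncurry G) := by
    have : Function.uncurry G = {p : ℝ × EuclideanSpace ℝ (Fin d) | ‖p.2‖ < p.1}.indicator
        (fun p => ENNReal.ofReal ((p.1 - ‖p.2‖) ^ (-b))) := by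
      ext p
      simp [G, Function.uncurry, indicator]
    rw [this]
    refine Measurable.indicator (by fun_prop) ?_
    exact measurableSet_lt (by fun_prop) (by fun_prop)
  have hdil : ∀ l ∈ Ioo (1 - r / 2) 1,
      ∫⁻ v in E, ENNReal.ofReal ((1 - ‖v‖) ^ (-b)) ≤ 2 ^ d * ∫⁻ w in B, G l w := by
    intro l hl
    have hl0 : 0 < l := by linarith [hl.1]
    refine setLIntegral_le_of_smul_mapsTo (measurableSet_ball.inter measurableSet_ball)
      measurableSet_ball (l := l) (g := G l) (by linarith [hl.1]) ?_ hG.of_uncurry_left ?_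
    · rintro v ⟨hv1, hvr⟩
      rw [mem_ball_zero_iff] at hv1
      rw [mem_ball, dist_eq_norm] at hvr
      change l • v ∈ ball Q (2 * r)
      rw [mem_ball, dist_eq_norm, show l • v - Q = (v - Q) - (1 - l) • v by module]
      refine (norm_sub_le _ _).trans_lt ?_
      rw [norm_smul, Real.norm_of_nonneg (by linarith [hl.2])]
      nlinarith [hl.1, hl.2, norm_nonneg v]
    · rintro v ⟨hv1, -⟩
      rw [mem_ball_zero_iff] at hv1
      have hn : ‖l • v‖ = l * ‖v‖ := by rw [norm_smul, Real.norm_of_nonneg hl0.le]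
      have hlt : ‖l • v‖ < l := by rw [hn]; nlinarith
      change _ ≤ (Ioi ‖l • v‖).indicator _ l
      rw [indicator_of_mem (mem_Ioi.mpr hlt)]
      refine ENNReal.ofReal_le_ofReal
        (Real.rpow_le_rpow_of_nonpos (by linarith) ?_ (by linarith))
      rw [hn]
      nlinarith [hl.2]
  calc ENNReal.ofReal (r / 2) * ∫⁻ v in E, ENNReal.ofReal ((1 - ‖v‖) ^ (-b))
      = ∫⁻ _ in Ioo (1 - r / 2) 1, ∫⁻ v in E, ENNReal.ofReal ((1 - ‖v‖) ^ (-b)) := by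
        rw [setLIntegral_const, Real.volume_Ioo, mul_comm]
        congr 2
        ring
    _ ≤ ∫⁻ l in Ioo (1 - r / 2) 1, 2 ^ d * ∫⁻ w in B, G l w :=
        setLIntegral_mono' measurableSet_Ioo hdil
    _ = 2 ^ d * ∫⁻ w in B, ∫⁻ l in Ioo (1 - r / 2) 1, G l w := by
        rw [lintegral_const_mul' _ _ (by finiteness), lintegral_lintegral_swap hG.aemeasurable]
    _ ≤ 2 ^ d * ∫⁻ _ in B, ENNReal.ofReal ((r / 2) ^ (1 - b) / (1 - b)) := by
        gcongr with w
        exact lintegral_indicator_sub_rpow_neg_le hb0 hb1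
    _ = _ := by rw [setLIntegral_const]

/-- There is `C = C(d,α)` such that for every `Q` on the unit sphere and every
`r ∈ (0,1]`, `∫_{B(0,1) ∩ B(Q,r)} (1−|v|)^{-α/2} dv ≤ C r^{d−α/2}`. -/
theorem stmt11 (d : ℕ) (hd : 2 ≤ d) (α : ℝ) (hα : α ∈ Set.Ioo (0 : ℝ) 2) :
    ∃ C : ℝ, 0 < C ∧
      ∀ Q : EuclideanSpace ℝ (Fin d), ‖Q‖ = 1 →
      ∀ r ∈ Set.Ioc (0 : ℝ) 1,
        IntegrableOn (fun v : EuclideanSpace ℝ (Fin d) => (1 - ‖v‖) ^ (-(α / 2)))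
          (ball (0 : EuclideanSpace ℝ (Fin d)) 1 ∩ ball Q r) ∧
        (∫ v in ball (0 : EuclideanSpace ℝ (Fin d)) 1 ∩ ball Q r,
            (1 - ‖v‖) ^ (-(α / 2))) ≤ C * r ^ ((d : ℝ) - α / 2) := by
  obtain ⟨hα0, hα2⟩ := hα
  set b := α / 2
  have hb0 : 0 ≤ b := by simp only [b]; linarith
  have hb1 : b < 1 := by simp only [b]; linarith
  have h1b : 0 < 1 - b := by linarith
  set c := volume.real (ball (0 : EuclideanSpace ℝ (Fin d)) 1) with hc
  have hc0 : 0 < c := ENNReal.toReal_pos (measure_ball_pos _ _ one_pos).ne' measure_ball_lt_top.ne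
  refine ⟨4 ^ d * c * 2 ^ b / (1 - b), by positivity, ?_⟩
  rintro Q - r ⟨hr0, hr1⟩
  set E := ball (0 : EuclideanSpace ℝ (Fin d)) 1 ∩ ball Q r
  set f : EuclideanSpace ℝ (Fin d) → ℝ := fun v => (1 - ‖v‖) ^ (-b)
  have hnonneg : 0 ≤ᵐ[volume.restrict E] f := by
    filter_upwards [ae_restrict_mem (measurableSet_ball.inter measurableSet_ball)] with v hv
    exact Real.rpow_nonneg (by linarith [mem_ball_zero_iff.mp hv.1]) _
  have hmeas : Measurable f := by fun_prop
  have hbound : ∫⁻ v in E, ENNReal.ofReal (f v)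
      ≤ ENNReal.ofReal (4 ^ d * c * 2 ^ b / (1 - b) * r ^ ((d : ℝ) - b)) := by
    have key := lintegral_ball_inter_ball_le (Q := Q) hb0 hb1 hr0 hr1
    have hvol : volume (ball Q (2 * r)) = ENNReal.ofReal ((2 * r) ^ d * c) := by
      rw [Measure.addHaar_ball_of_pos _ _ (by positivity), finrank_euclideanSpace_fin,
        ENNReal.ofReal_mul (by positivity), hc, ofReal_measureReal]
    have hr2 : ENNReal.ofReal (r / 2) ≠ 0 := by simpa using hr0
    rw [← ENNReal.mul_le_mul_iff_right hr2 ENNReal.ofReal_ne_top]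
    refine key.trans (le_of_eq ?_)
    rw [hvol, show (2 : ENNReal) ^ d = ENNReal.ofReal (2 ^ d) by
        rw [ENNReal.ofReal_pow (by norm_num)]; simp,
      ← ENNReal.ofReal_mul (by positivity), ← ENNReal.ofReal_mul (by positivity),
      ← ENNReal.ofReal_mul (by positivity)]
    congr 1
    rw [Real.rpow_sub (by positivity), Real.rpow_one, Real.rpow_sub hr0, Real.rpow_natCast,
      Real.div_rpow hr0.le (by norm_num), mul_pow, show (4 : ℝ) = 2 * 2 by norm_num, mul_pow]
    have := Real.rpow_pos_of_pos hr0 b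
    have := Real.rpow_pos_of_pos (two_pos : (0 : ℝ) < 2) b
    field_simp
  refine ⟨⟨hmeas.aestronglyMeasurable, ?_⟩, ?_⟩
  · rw [hasFiniteIntegral_iff_ofReal hnonneg]
    exact hbound.trans_lt ENNReal.ofReal_lt_top
  · rw [integral_eq_lintegral_of_nonneg_ae hnonneg hmeas.aestronglyMeasurable]
    exact ENNReal.toReal_le_of_le_ofReal (by positivity) hbound
end

section
/- There is a constant C = C(d,α) such that for every measurable g : ℝ^d → ℝ which is bounded on B(0,2) \ B(0,1) and satisfies ‖g‖_{L¹(1∧ν)} := ∫_{ℝ^d \ B(0,1)} |g(z)| (1 ∧ |z|^{-d-α}) dz < ∞, and for every y ∈ B(0,1): ∫_{ℝ^d \ B(0,1)} |g(z)| ν(y − z) dz ≤ C (1 − |y|)^{-α} ( ‖g‖_{L^∞(B(0,2) \ B(0,1))} + ‖g‖_{L¹(1∧ν)} ). -/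
open MeasureTheory Set Metric

lemma measurable_norm_rpow {E : Type*} [NormedAddCommGroup E] [MeasurableSpace E] [BorelSpace E]
    (b : ℝ) : Measurable fun w : E => ‖w‖ ^ b :=
  measurable_norm.pow_const b

section PowerTail

variable {E : Type*} [NormedAddCommGroup E] [NormedSpace ℝ E] [FiniteDimensional ℝ E]
  [MeasurableSpace E] [BorelSpace E] (μ : Measure E) [μ.IsAddHaarMeasure]

lemma integrableOn_norm_rpow_compl_ball {r δ : ℝ} (hr : (Module.finrank ℝ E : ℝ) < r)
    (hδ : 0 < δ) : IntegrableOn (fun w : E => ‖w‖ ^ (-r)) (ball 0 δ)ᶜ μ := by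
  have hr0 : 0 ≤ r := (Nat.cast_nonneg _).trans hr.le
  refine Integrable.mono' (((integrable_one_add_norm (μ := μ) hr).const_mul
    ((δ / (1 + δ)) ^ (-r))).integrableOn) (measurable_norm_rpow _).aestronglyMeasurable ?_
  refine (ae_restrict_iff' measurableSet_ball.compl).2 (.of_forall fun w hw => ?_)
  have hw' : δ ≤ ‖w‖ := by simpa using hw
  rw [Real.norm_of_nonneg (by positivity), ← Real.mul_rpow (by positivity) (by positivity)]
  refine Real.rpow_le_rpow_of_nonpos (by positivity) ?_ (by linarith)
  rw [div_mul_eq_mul_div, div_le_iff₀ (by positivity)]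
  nlinarith

open scoped Pointwise in
lemma setIntegral_norm_rpow_compl_ball {r δ : ℝ} (hδ : 0 < δ) :
    ∫ w in (ball (0 : E) δ)ᶜ, ‖w‖ ^ (-r) ∂μ =
      δ ^ (Module.finrank ℝ E - r) * ∫ w in (ball (0 : E) 1)ᶜ, ‖w‖ ^ (-r) ∂μ := by
  have h := Measure.setIntegral_comp_smul_of_pos μ (fun w : E => ‖w‖ ^ (-r)) (ball 0 1)ᶜ hδ
  have hs : δ • (ball (0 : E) 1)ᶜ = (ball 0 δ)ᶜ := by
    rw [← smul_unitBall_of_pos hδ]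
    exact smul_set_compl (a := Units.mk0 δ hδ.ne')
  simp only [hs, norm_smul, Real.norm_of_nonneg hδ.le, smul_eq_mul,
    Real.mul_rpow hδ.le (norm_nonneg _), integral_const_mul] at h
  rw [sub_eq_add_neg, Real.rpow_add hδ, Real.rpow_natCast, mul_assoc, h]
  field_simp

end PowerTail

/-- There is `C = C(d,α)` such that for every measurable `g` bounded by `M` on
`B(0,2) \ B(0,1)` and with `∫_{ℝ^d \ B(0,1)} |g(z)| (1 ∧ |z|^{-d-α}) dz < ∞`,
and every `y ∈ B(0,1)`,
`∫_{ℝ^d \ B(0,1)} |g(z)| ν(y−z) dz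
  ≤ C (1−|y|)^{-α} (M + ‖g‖_{L¹(1∧ν)})`, where `ν(w) = c‖w‖^{-d-α}`. -/
theorem stmt14 (d : ℕ) (hd : 2 ≤ d) (α : ℝ) (hα : α ∈ Set.Ioo (0 : ℝ) 2)
    (c : ℝ) (hc : 0 < c) :
    ∃ C : ℝ, 0 < C ∧
      ∀ g : EuclideanSpace ℝ (Fin d) → ℝ, Measurable g →
      ∀ M : ℝ,
      (∀ z ∈ ball (0 : EuclideanSpace ℝ (Fin d)) 2 \ ball (0 : EuclideanSpace ℝ (Fin d)) 1,
        |g z| ≤ M) →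
      IntegrableOn (fun z => |g z| * min 1 (‖z‖ ^ (-(d : ℝ) - α)))
        (ball (0 : EuclideanSpace ℝ (Fin d)) 1)ᶜ →
      ∀ y ∈ ball (0 : EuclideanSpace ℝ (Fin d)) 1,
        IntegrableOn (fun z => |g z| * (c * ‖y - z‖ ^ (-(d : ℝ) - α)))
          (ball (0 : EuclideanSpace ℝ (Fin d)) 1)ᶜ ∧
        (∫ z in (ball (0 : EuclideanSpace ℝ (Fin d)) 1)ᶜ,
            |g z| * (c * ‖y - z‖ ^ (-(d : ℝ) - α)))
          ≤ C * (1 - ‖y‖) ^ (-α) *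
            (M + ∫ z in (ball (0 : EuclideanSpace ℝ (Fin d)) 1)ᶜ,
              |g z| * min 1 (‖z‖ ^ (-(d : ℝ) - α))) := by
  obtain ⟨hα0, -⟩ := hα
  have : Nontrivial (EuclideanSpace ℝ (Fin d)) :=
    Module.nontrivial_of_finrank_pos (R := ℝ) (by rw [finrank_euclideanSpace_fin]; omega)
  set r : ℝ := d + α with hr
  have hβ : -(d : ℝ) - α = -r := by rw [hr]; ring
  simp only [hβ]
  have hr0 : 0 < r := by positivity
  set K : ℝ := ∫ w in (ball (0 : EuclideanSpace ℝ (Fin d)) 1)ᶜ, ‖w‖ ^ (-r) with hK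
  have hK0 : 0 ≤ K := integral_nonneg fun w => by positivity
  refine ⟨c * (K + 2 ^ r), by positivity, fun g hg M hM hN y hy => ?_⟩
  set N : ℝ := ∫ z in (ball (0 : EuclideanSpace ℝ (Fin d)) 1)ᶜ, |g z| * min 1 (‖z‖ ^ (-r)) with hNdef
  have hN0 : 0 ≤ N := integral_nonneg fun w => by positivity
  have hM0 : 0 ≤ M := by
    obtain ⟨z, hz⟩ := exists_norm_eq (EuclideanSpace ℝ (Fin d)) zero_le_one
    exact (abs_nonneg _).trans (hM z (by simp [hz]))
  have hy1 : ‖y‖ < 1 := by simpa using hy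
  set δ : ℝ := 1 - ‖y‖ with hδdef
  have hδ : 0 < δ := by linarith
  set h : EuclideanSpace ℝ (Fin d) → ℝ := (ball 0 δ)ᶜ.indicator fun w => ‖w‖ ^ (-r) with hh
  have hh0 : ∀ w, 0 ≤ h w := fun w => indicator_nonneg (fun w _ => by positivity) w
  have hhi : Integrable h :=
    (integrableOn_norm_rpow_compl_ball volume (by simp [hr, hα0]) hδ).integrable_indicator
      measurableSet_ball.compl
  have hhI : ∫ z, h (y - z) = δ ^ (-α) * K := by
    rw [integral_sub_left_eq_self h volume y, hh, integral_indicator measurableSet_ball.compl,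
      setIntegral_norm_rpow_compl_ball volume hδ, finrank_euclideanSpace_fin,
      show (d : ℝ) - r = -α by rw [hr]; ring]
  have hhy : Integrable fun z => h (y - z) := hhi.comp_sub_left y
  have hbound : ∀ z ∈ (ball (0 : EuclideanSpace ℝ (Fin d)) 1)ᶜ,
      |g z| * (c * ‖y - z‖ ^ (-r)) ≤
        c * M * h (y - z) + c * 2 ^ r * (|g z| * min 1 (‖z‖ ^ (-r))) := by
    intro z hz
    have hz1 : 1 ≤ ‖z‖ := by simpa using hz
    have hyz : ‖z‖ - ‖y‖ ≤ ‖y - z‖ := norm_sub_rev y z ▸ norm_sub_norm_le z y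
    by_cases hz2 : ‖z‖ < 2
    · have hhz : h (y - z) = ‖y - z‖ ^ (-r) :=
        indicator_of_mem (by simp only [mem_compl_iff, mem_ball_zero_iff, not_lt]; linarith) _
      have hgz : |g z| ≤ M := hM z ⟨by simpa using hz2, hz⟩
      calc |g z| * (c * ‖y - z‖ ^ (-r)) ≤ M * (c * ‖y - z‖ ^ (-r)) := by gcongr
        _ = c * M * h (y - z) := by rw [hhz]; ring
        _ ≤ _ := le_add_of_nonneg_right (by positivity)
    · have hmin : min 1 (‖z‖ ^ (-r)) = ‖z‖ ^ (-r) :=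
        min_eq_right (Real.rpow_le_one_of_one_le_of_nonpos hz1 (by linarith))
      have hfar : ‖y - z‖ ^ (-r) ≤ 2 ^ r * ‖z‖ ^ (-r) := by
        calc ‖y - z‖ ^ (-r) ≤ (2⁻¹ * ‖z‖) ^ (-r) :=
              Real.rpow_le_rpow_of_nonpos (by positivity) (by linarith) (by linarith)
          _ = 2 ^ r * ‖z‖ ^ (-r) := by
              rw [Real.mul_rpow (by positivity) (by positivity), Real.inv_rpow (by positivity),
                Real.rpow_neg (by positivity : (0 : ℝ) ≤ 2), inv_inv]
      calc |g z| * (c * ‖y - z‖ ^ (-r)) ≤ |g z| * (c * (2 ^ r * ‖z‖ ^ (-r))) := by gcongr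
        _ = c * 2 ^ r * (|g z| * min 1 (‖z‖ ^ (-r))) := by rw [hmin]; ring
        _ ≤ _ := le_add_of_nonneg_left (by have := hh0 (y - z); positivity)
  have hnear : IntegrableOn (fun z => c * M * h (y - z))
      (ball (0 : EuclideanSpace ℝ (Fin d)) 1)ᶜ := (hhy.const_mul _).integrableOn
  have hfar := hN.const_mul (c * 2 ^ r)
  have hint : IntegrableOn (fun z => |g z| * (c * ‖y - z‖ ^ (-r)))
      (ball (0 : EuclideanSpace ℝ (Fin d)) 1)ᶜ := by
    refine Integrable.mono' (hnear.add hfar) (Measurable.aestronglyMeasurable ?_) ?_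
    · exact hg.abs.mul (((measurable_norm_rpow _).comp (measurable_id.const_sub y)).const_mul c)
    · refine (ae_restrict_iff' measurableSet_ball.compl).2 (.of_forall fun z hz => ?_)
      rw [Real.norm_of_nonneg (by positivity)]
      exact hbound z hz
  refine ⟨hint, ?_⟩
  have hδ1 : 1 ≤ δ ^ (-α) :=
    Real.one_le_rpow_of_pos_of_le_one_of_nonpos hδ
      (by linarith [norm_nonneg y]) (by linarith)
  calc ∫ z in (ball (0 : EuclideanSpace ℝ (Fin d)) 1)ᶜ, |g z| * (c * ‖y - z‖ ^ (-r))
      ≤ ∫ z in (ball (0 : EuclideanSpace ℝ (Fin d)) 1)ᶜ,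
          (c * M * h (y - z) + c * 2 ^ r * (|g z| * min 1 (‖z‖ ^ (-r)))) :=
        setIntegral_mono_on hint (hnear.add hfar) measurableSet_ball.compl hbound
    _ = c * M * (∫ z in (ball (0 : EuclideanSpace ℝ (Fin d)) 1)ᶜ, h (y - z)) + c * 2 ^ r * N := by
        rw [integral_add hnear hfar, integral_const_mul, integral_const_mul]
    _ ≤ c * M * (δ ^ (-α) * K) + c * 2 ^ r * (δ ^ (-α) * N) := by
        gcongr
        · exact hhI ▸ setIntegral_le_integral hhy (.of_forall fun z => hh0 (y - z))
        · exact le_mul_of_one_le_left hN0 hδ1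
    _ ≤ c * (K + 2 ^ r) * δ ^ (-α) * (M + N) := by
        have : 0 ≤ c * δ ^ (-α) * (2 ^ r * M + K * N) := by positivity
        linarith
end

section
/- Let g : ℝ^d → ℝ be measurable, bounded on B(0,2) \ B(0,1), vanishing on B(0,1), and with ∫_{ℝ^d \ B(0,1)} |g(z)| (1 ∧ |z|^{-d-α}) dz < ∞, and define f(y) = ∫_{ℝ^d \ B(0,1)} g(z) ν(y − z) dz for y ∈ B(0,1). Then f is continuously differentiable on B(0,1), differentiation under the integral sign is valid, and there is C = C(d,α) such that |∇f(y)| ≤ C (1 − |y|)^{-α-1} ( ‖g‖_{L^∞(B(0,2) \ B(0,1))} + ∫_{ℝ^d \ B(0,1)} |g(z)| (1 ∧ |z|^{-d-α}) dz ) for every y ∈ B(0,1). -/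
open MeasureTheory Set Metric

/-- The "exterior sweep" `f(y) = ∫_{ℝ^d \ B(0,1)} g(z) ν(y−z) dz`,
with `ν(w) = c‖w‖^{-d-α}`. -/
noncomputable def extSweep (d : ℕ) (α c : ℝ) (g : EuclideanSpace ℝ (Fin d) → ℝ)
    (y : EuclideanSpace ℝ (Fin d)) : ℝ :=
  ∫ z in (ball (0 : EuclideanSpace ℝ (Fin d)) 1)ᶜ,
    g z * (c * ‖y - z‖ ^ (-(d : ℝ) - α))

section InnerProductSpace

variable {E : Type*} [NormedAddCommGroup E] [InnerProductSpace ℝ E]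

theorem hasGradientAt_const_mul_norm_sub_rpow [CompleteSpace E] (c s : ℝ) {w z : E}
    (h : w ≠ z) :
    HasGradientAt (fun x => c * ‖x - z‖ ^ s) ((c * s * ‖w - z‖ ^ (s - 2)) • (w - z)) w := by
  have hpos : 0 < ‖w - z‖ := norm_pos_iff.2 (sub_ne_zero.2 h)
  have hsq : ∀ (x : E) (t : ℝ), (‖x - z‖ ^ 2) ^ t = ‖x - z‖ ^ (2 * t) := fun x t => by
    rw [Real.rpow_mul (norm_nonneg _), Real.rpow_two]
  have key := ((((hasFDerivAt_id w).sub_const z).norm_sq).rpow_const (p := s / 2)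
    (Or.inl (by simpa using (pow_pos hpos 2).ne'))).const_mul c
  rw [hasGradientAt_iff_hasFDerivAt]
  have hfun : (fun x => c * ‖x - z‖ ^ s) = fun x => c * (‖id x - z‖ ^ 2) ^ (s / 2) := by
    funext x
    rw [id, hsq]
    ring_nf
  rw [hfun]
  refine key.congr_fderiv ?_
  ext v
  have hexp : 2 * (s / 2 - 1) = s - 2 := by ring
  simp [hsq, hexp]
  ring

theorem norm_smul_norm_rpow_sub_two (a s : ℝ) {w : E} (h : w ≠ 0) :
    ‖(a * ‖w‖ ^ (s - 2)) • w‖ = |a| * ‖w‖ ^ (s - 1) := by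
  have hpos : 0 < ‖w‖ := norm_pos_iff.2 h
  rw [norm_smul, norm_mul, Real.norm_eq_abs, Real.norm_of_nonneg (by positivity), mul_assoc,
    ← Real.rpow_add_one hpos.ne']
  ring_nf

end InnerProductSpace

section NormedSpace

variable {E : Type*} [NormedAddCommGroup E]

theorem ne_of_mem_unitBall_of_one_le_norm {y z : E} (hy : y ∈ ball (0 : E) 1)
    (hz : 1 ≤ ‖z‖) : y ≠ z := by
  rintro rfl
  exact absurd (mem_ball_zero_iff.1 hy) (not_lt.2 hz)

theorem exists_uniform_ball {y : E} (hy : y ∈ ball (0 : E) 1) :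
    ∃ ε : ℝ, 0 < ε ∧ ε ≤ 1 ∧ ∀ x ∈ ball y ε, ‖x‖ ≤ 1 - ε := by
  rw [mem_ball_zero_iff] at hy
  refine ⟨(1 - ‖y‖) / 2, by linarith, by linarith [norm_nonneg y], fun x hx => ?_⟩
  rw [mem_ball, dist_eq_norm] at hx
  linarith [norm_sub_norm_le x y]

theorem mul_norm_le_norm_sub {ε : ℝ} {y z : E} (hε : ε ≤ 1) (hy : ‖y‖ ≤ 1 - ε)
    (hz : 1 ≤ ‖z‖) : ε * ‖z‖ ≤ ‖y - z‖ := by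
  have h := norm_sub_norm_le z y
  rw [norm_sub_rev] at h
  nlinarith

theorem norm_sub_rpow_neg_le {ε : ℝ} {y z : E} (hε₀ : 0 < ε) (hε : ε ≤ 1)
    (hy : ‖y‖ ≤ 1 - ε) (hz : 1 ≤ ‖z‖) {s : ℝ} (hs : s ≤ 0) :
    ‖y - z‖ ^ s ≤ ε ^ s * ‖z‖ ^ s := by
  rw [← Real.mul_rpow hε₀.le (norm_nonneg z)]
  exact Real.rpow_le_rpow_of_nonpos (by positivity) (mul_norm_le_norm_sub hε hy hz) hs

theorem indicator_compl_ball_norm_sub_rpow [NormedSpace ℝ E] (y : E) {δ : ℝ} (hδ : 0 < δ) (r : ℝ) :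
    (ball y δ)ᶜ.indicator (fun z => ‖y - z‖ ^ r) =
      fun z => δ ^ r * (ball (0 : E) 1)ᶜ.indicator (fun u => ‖u‖ ^ r) (δ⁻¹ • (y - z)) := by
  funext z
  have hn : ‖δ⁻¹ • (y - z)‖ = δ⁻¹ * ‖y - z‖ := by
    rw [norm_smul, Real.norm_of_nonneg (by positivity)]
  have hmem : δ⁻¹ • (y - z) ∈ (ball (0 : E) 1)ᶜ ↔ z ∈ (ball y δ)ᶜ := by
    rw [mem_compl_iff, mem_compl_iff, mem_ball_zero_iff, hn, mem_ball, dist_comm, dist_eq_norm,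
      inv_mul_lt_iff₀ hδ, mul_one]
  by_cases hz : z ∈ (ball y δ)ᶜ
  · rw [indicator_of_mem hz, indicator_of_mem (hmem.2 hz), hn,
      ← Real.mul_rpow hδ.le (by positivity), mul_inv_cancel_left₀ hδ.ne']
  · rw [indicator_of_notMem hz, indicator_of_notMem (hmem.not.2 hz), mul_zero]

variable [NormedSpace ℝ E] [FiniteDimensional ℝ E] [MeasurableSpace E] [BorelSpace E]
  (μ : Measure E) [μ.IsAddHaarMeasure]

theorem integrableOn_compl_unitBall_norm_rpow {r : ℝ} (hr : (Module.finrank ℝ E : ℝ) < r) :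
    IntegrableOn (fun u : E => ‖u‖ ^ (-r)) (ball 0 1)ᶜ μ := by
  have hr₀ : 0 ≤ r := (Nat.cast_nonneg _).trans hr.le
  refine Integrable.mono' ((integrable_one_add_norm (μ := μ) hr).const_mul
    ((1 / 2 : ℝ) ^ (-r))).integrableOn (Measurable.aestronglyMeasurable (by fun_prop)) ?_
  refine (ae_restrict_iff' measurableSet_ball.compl).2 (ae_of_all _ fun u hu => ?_)
  have hu' : 1 ≤ ‖u‖ := by simpa using hu
  rw [Real.norm_of_nonneg (by positivity), ← Real.mul_rpow (by positivity) (by positivity)]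
  exact Real.rpow_le_rpow_of_nonpos (by positivity) (by linarith) (by linarith)

theorem integrableOn_compl_ball_norm_sub_rpow (y : E) {δ r : ℝ} (hδ : 0 < δ)
    (hr : (Module.finrank ℝ E : ℝ) < r) :
    IntegrableOn (fun z : E => ‖y - z‖ ^ (-r)) (ball y δ)ᶜ μ := by
  rw [← integrable_indicator_iff measurableSet_ball.compl,
    indicator_compl_ball_norm_sub_rpow y hδ]
  exact ((((integrable_indicator_iff measurableSet_ball.compl).2
    (integrableOn_compl_unitBall_norm_rpow μ hr)).comp_smul (inv_pos.2 hδ).ne').comp_sub_left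
      y).const_mul _

theorem setIntegral_compl_ball_norm_sub_rpow (y : E) {δ : ℝ} (hδ : 0 < δ) (r : ℝ) :
    ∫ z in (ball y δ)ᶜ, ‖y - z‖ ^ r ∂μ =
      δ ^ (r + Module.finrank ℝ E) * ∫ u in (ball (0 : E) 1)ᶜ, ‖u‖ ^ r ∂μ := by
  rw [← integral_indicator measurableSet_ball.compl,
    ← integral_indicator measurableSet_ball.compl, indicator_compl_ball_norm_sub_rpow y hδ,
    integral_const_mul, integral_sub_left_eq_self
      (fun w => (ball (0 : E) 1)ᶜ.indicator (fun u => ‖u‖ ^ r) (δ⁻¹ • w)) μ y,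
    Measure.integral_comp_smul, smul_eq_mul, ← mul_assoc, inv_pow, inv_inv,
    abs_of_pos (pow_pos hδ _), Real.rpow_add hδ, Real.rpow_natCast]

end NormedSpace

section ExteriorIntegral

variable {E : Type*} [NormedAddCommGroup E] [InnerProductSpace ℝ E]

theorem norm_smul_rpow_smul_le {g : E → ℝ} {c s ε : ℝ} {y z : E} (hs : s ≤ 0) (hε₀ : 0 < ε)
    (hε : ε ≤ 1) (hy : ‖y‖ ≤ 1 - ε) (hz : 1 ≤ ‖z‖) :
    ‖g z • ((c * s * ‖y - z‖ ^ (s - 2)) • (y - z))‖ ≤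
      |c * s| * ε ^ (s - 1) * (|g z| * ‖z‖ ^ s) := by
  have hne : y ≠ z := ne_of_mem_unitBall_of_one_le_norm (by rw [mem_ball_zero_iff]; linarith) hz
  rw [norm_smul, norm_smul_norm_rpow_sub_two _ _ (sub_ne_zero.2 hne), Real.norm_eq_abs]
  have h₁ : ‖y - z‖ ^ (s - 1) ≤ ε ^ (s - 1) * ‖z‖ ^ s :=
    (norm_sub_rpow_neg_le hε₀ hε hy hz (by linarith)).trans <|
      mul_le_mul_of_nonneg_left (Real.rpow_le_rpow_of_exponent_le hz (by linarith)) (by positivity)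
  calc |g z| * (|c * s| * ‖y - z‖ ^ (s - 1))
      ≤ |g z| * (|c * s| * (ε ^ (s - 1) * ‖z‖ ^ s)) := by gcongr
    _ = _ := by ring

variable [MeasurableSpace E] [BorelSpace E] [FiniteDimensional ℝ E] {μ : Measure E}
  {g : E → ℝ} {c s : ℝ}

theorem integrableOn_smul_rpow_smul (hg : Measurable g) (hs : s ≤ 0)
    (hint : IntegrableOn (fun z => |g z| * ‖z‖ ^ s) (ball 0 1)ᶜ μ) {y : E}
    (hy : y ∈ ball (0 : E) 1) :
    IntegrableOn (fun z => g z • ((c * s * ‖y - z‖ ^ (s - 2)) • (y - z))) (ball 0 1)ᶜ μ := by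
  rw [mem_ball_zero_iff] at hy
  refine Integrable.mono' (Integrable.const_mul hint (|c * s| * (1 - ‖y‖) ^ (s - 1)))
    (Measurable.aestronglyMeasurable (by fun_prop))
    ((ae_restrict_iff' measurableSet_ball.compl).2 (ae_of_all _ fun z hz => ?_))
  exact norm_smul_rpow_smul_le hs (by linarith) (by linarith [norm_nonneg y]) (by linarith)
    (by simpa using hz)

theorem continuousOn_setIntegral_smul_rpow_smul (hg : Measurable g) (hs : s ≤ 0)
    (hint : IntegrableOn (fun z => |g z| * ‖z‖ ^ s) (ball 0 1)ᶜ μ) :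
    ContinuousOn
      (fun y => ∫ z in (ball (0 : E) 1)ᶜ, g z • ((c * s * ‖y - z‖ ^ (s - 2)) • (y - z)) ∂μ)
      (ball 0 1) := by
  intro y hy
  obtain ⟨ε, hε₀, hε, hball⟩ := exists_uniform_ball hy
  refine (continuousAt_of_dominated
    (bound := fun z => |c * s| * ε ^ (s - 1) * (|g z| * ‖z‖ ^ s))
    (Filter.Eventually.of_forall fun x => Measurable.aestronglyMeasurable (by fun_prop))
    ?_ (Integrable.const_mul hint _) ?_).continuousWithinAt
  · filter_upwards [ball_mem_nhds y hε₀] with x hx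
    exact (ae_restrict_iff' measurableSet_ball.compl).2 (ae_of_all _ fun z hz =>
      norm_smul_rpow_smul_le hs hε₀ hε (hball x hx) (by simpa using hz))
  · refine (ae_restrict_iff' measurableSet_ball.compl).2 (ae_of_all _ fun z hz => ?_)
    have hne : ‖y - z‖ ≠ 0 := norm_ne_zero_iff.2 <| sub_ne_zero.2 <|
      ne_of_mem_unitBall_of_one_le_norm hy (by simpa using hz)
    have hcont : ContinuousAt (fun x : E => ‖x - z‖) y := by fun_prop
    exact (((hcont.rpow_const (Or.inl hne)).const_mul _).smul (by fun_prop)).const_smul _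

theorem hasGradientAt_setIntegral_mul_rpow (hg : Measurable g) (hs : s ≤ 0)
    (hint : IntegrableOn (fun z => |g z| * ‖z‖ ^ s) (ball 0 1)ᶜ μ) {y : E}
    (hy : y ∈ ball (0 : E) 1) :
    HasGradientAt (fun y => ∫ z in (ball (0 : E) 1)ᶜ, g z * (c * ‖y - z‖ ^ s) ∂μ)
      (∫ z in (ball (0 : E) 1)ᶜ, g z • ((c * s * ‖y - z‖ ^ (s - 2)) • (y - z)) ∂μ) y := by
  obtain ⟨ε, hε₀, hε, hball⟩ := exists_uniform_ball hy
  have hmem : ∀ x ∈ ball y ε, x ∈ ball (0 : E) 1 := fun x hx => by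
    rw [mem_ball_zero_iff]
    linarith [hball x hx]
  have key := hasFDerivAt_integral_of_dominated_of_fderiv_le (𝕜 := ℝ)
    (μ := μ.restrict (ball (0 : E) 1)ᶜ) (F := fun y z => g z * (c * ‖y - z‖ ^ s))
    (F' := fun y z =>
      InnerProductSpace.toDual ℝ E (g z • ((c * s * ‖y - z‖ ^ (s - 2)) • (y - z))))
    (bound := fun z => |c * s| * ε ^ (s - 1) * (|g z| * ‖z‖ ^ s)) (x₀ := y)
    (ball_mem_nhds y hε₀)
    (Filter.Eventually.of_forall fun x => Measurable.aestronglyMeasurable (by fun_prop))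
    ?_ ?_ ?_ (Integrable.const_mul hint _) ?_
  · rw [hasGradientAt_iff_hasFDerivAt]
    refine key.congr_fderiv ?_
    exact ContinuousLinearMap.integral_comp_commSL (by simp)
      (InnerProductSpace.toDual ℝ E).toContinuousLinearEquiv.toContinuousLinearMap
      (integrableOn_smul_rpow_smul hg hs hint hy)
  · refine Integrable.mono' (Integrable.const_mul hint (|c| * ε ^ s))
      (Measurable.aestronglyMeasurable (by fun_prop))
      ((ae_restrict_iff' measurableSet_ball.compl).2 (ae_of_all _ fun z hz => ?_))
    have h₁ := norm_sub_rpow_neg_le hε₀ hε (hball y (mem_ball_self hε₀))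
      (by simpa using hz : 1 ≤ ‖z‖) hs
    rw [norm_mul, norm_mul, Real.norm_eq_abs, Real.norm_eq_abs,
      Real.norm_of_nonneg (by positivity)]
    calc |g z| * (|c| * ‖y - z‖ ^ s) ≤ |g z| * (|c| * (ε ^ s * ‖z‖ ^ s)) := by gcongr
      _ = _ := by ring
  · exact (InnerProductSpace.toDual ℝ E).continuous.comp_aestronglyMeasurable
      (Measurable.aestronglyMeasurable (by fun_prop))
  · refine (ae_restrict_iff' measurableSet_ball.compl).2 (ae_of_all _ fun z hz x hx => ?_)
    rw [LinearIsometryEquiv.norm_map]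
    exact norm_smul_rpow_smul_le hs hε₀ hε (hball x hx) (by simpa using hz)
  · refine (ae_restrict_iff' measurableSet_ball.compl).2 (ae_of_all _ fun z hz x hx => ?_)
    have hne := ne_of_mem_unitBall_of_one_le_norm (hmem x hx) (by simpa using hz : 1 ≤ ‖z‖)
    refine (((hasGradientAt_const_mul_norm_sub_rpow c s hne).hasFDerivAt).const_mul
      (g z)).congr_fderiv ?_
    ext v
    simp

theorem norm_setIntegral_smul_rpow_smul_le [μ.IsAddHaarMeasure] (hs : s ≤ 0)
    (hs' : (Module.finrank ℝ E : ℝ) < 1 - s)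
    (hint : IntegrableOn (fun z => |g z| * ‖z‖ ^ s) (ball 0 1)ᶜ μ) {M : ℝ} (hM₀ : 0 ≤ M)
    (hM : ∀ z ∈ ball (0 : E) 2 \ ball (0 : E) 1, |g z| ≤ M) {y : E}
    (hy : y ∈ ball (0 : E) 1) :
    ‖∫ z in (ball (0 : E) 1)ᶜ, g z • ((c * s * ‖y - z‖ ^ (s - 2)) • (y - z)) ∂μ‖ ≤
      |c * s| * (M * ((1 - ‖y‖) ^ (s - 1 + Module.finrank ℝ E) *
        ∫ u in (ball (0 : E) 1)ᶜ, ‖u‖ ^ (s - 1) ∂μ) +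
        (1 / 2) ^ (s - 1) * ∫ z in (ball (0 : E) 1)ᶜ, |g z| * ‖z‖ ^ s ∂μ) := by
  have hδ : 0 < 1 - ‖y‖ := by linarith [mem_ball_zero_iff.1 hy]
  have hsub : (ball (0 : E) 1)ᶜ ⊆ (ball y (1 - ‖y‖))ᶜ := by
    refine compl_subset_compl.2 (ball_subset_ball' ?_)
    simp
  have hker : IntegrableOn (fun z : E => ‖y - z‖ ^ (s - 1)) (ball y (1 - ‖y‖))ᶜ μ := by
    simpa using integrableOn_compl_ball_norm_sub_rpow μ y hδ hs'
  have hker' := hker.mono_set hsub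
  calc _ ≤ ∫ z in (ball (0 : E) 1)ᶜ, |c * s| * (M * ‖y - z‖ ^ (s - 1) +
        (1 / 2) ^ (s - 1) * (|g z| * ‖z‖ ^ s)) ∂μ := by
        refine norm_integral_le_of_norm_le
          (((Integrable.const_mul hker' M).add (Integrable.const_mul hint _)).const_mul _)
          ((ae_restrict_iff' measurableSet_ball.compl).2 (ae_of_all _ fun z hz => ?_))
        have hz₁ : 1 ≤ ‖z‖ := by simpa using hz
        have hne := ne_of_mem_unitBall_of_one_le_norm hy hz₁
        rw [norm_smul, norm_smul_norm_rpow_sub_two _ _ (sub_ne_zero.2 hne), Real.norm_eq_abs,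
          mul_left_comm]
        refine mul_le_mul_of_nonneg_left ?_ (abs_nonneg _)
        rcases lt_or_ge ‖z‖ 2 with h₂ | h₂
        · have h₃ := hM z ⟨by simpa using h₂, hz⟩
          have h₄ : |g z| * ‖y - z‖ ^ (s - 1) ≤ M * ‖y - z‖ ^ (s - 1) := by gcongr
          exact h₄.trans (le_add_of_nonneg_right (by positivity))
        · have h₃ : 1 / 2 * ‖z‖ ≤ ‖y - z‖ := by
            have := norm_sub_norm_le z y
            rw [norm_sub_rev] at this
            linarith
          have h₄ : ‖y - z‖ ^ (s - 1) ≤ (1 / 2) ^ (s - 1) * ‖z‖ ^ s := by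
            calc ‖y - z‖ ^ (s - 1) ≤ (1 / 2 * ‖z‖) ^ (s - 1) :=
                  Real.rpow_le_rpow_of_nonpos (by positivity) h₃ (by linarith)
              _ = (1 / 2) ^ (s - 1) * ‖z‖ ^ (s - 1) :=
                  Real.mul_rpow (by positivity) (by positivity)
              _ ≤ _ := mul_le_mul_of_nonneg_left
                  (Real.rpow_le_rpow_of_exponent_le hz₁ (by linarith)) (by positivity)
          calc |g z| * ‖y - z‖ ^ (s - 1) ≤ |g z| * ((1 / 2) ^ (s - 1) * ‖z‖ ^ s) := by gcongr
            _ = (1 / 2) ^ (s - 1) * (|g z| * ‖z‖ ^ s) := by ring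
            _ ≤ _ := le_add_of_nonneg_left (by positivity)
    _ = |c * s| * (M * ∫ z in (ball (0 : E) 1)ᶜ, ‖y - z‖ ^ (s - 1) ∂μ +
        (1 / 2) ^ (s - 1) * ∫ z in (ball (0 : E) 1)ᶜ, |g z| * ‖z‖ ^ s ∂μ) := by
        rw [integral_const_mul, integral_add (Integrable.const_mul hker' M)
          (Integrable.const_mul hint _), integral_const_mul, integral_const_mul]
    _ ≤ _ := by
        rw [← setIntegral_compl_ball_norm_sub_rpow μ y hδ]
        gcongr
        exact ae_of_all _ fun z => by positivity

end ExteriorIntegral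

/-- If `g` is measurable, bounded on `B(0,2) \ B(0,1)`, vanishes on `B(0,1)`,
and `∫_{ℝ^d \ B(0,1)} |g(z)| (1 ∧ |z|^{-d-α}) dz < ∞`, then
`f(y) = ∫_{ℝ^d \ B(0,1)} g(z) ν(y−z) dz` is continuously differentiable on
`B(0,1)`, differentiation under the integral sign is valid, and
`|∇f(y)| ≤ C (1−|y|)^{-α-1} (‖g‖_{L^∞(B(0,2)\B(0,1))} + ‖g‖_{L¹(1∧ν)})`
with `C = C(d,α)`. -/
theorem stmt15 (d : ℕ) (hd : 2 ≤ d) (α : ℝ) (hα : α ∈ Set.Ioo (0 : ℝ) 2)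
    (c : ℝ) (hc : 0 < c) :
    ∃ C : ℝ, 0 < C ∧
      ∀ g : EuclideanSpace ℝ (Fin d) → ℝ, Measurable g →
      (∀ z ∈ ball (0 : EuclideanSpace ℝ (Fin d)) 1, g z = 0) →
      IntegrableOn (fun z => |g z| * min 1 (‖z‖ ^ (-(d : ℝ) - α)))
        (ball (0 : EuclideanSpace ℝ (Fin d)) 1)ᶜ →
      ∀ M : ℝ,
      (∀ z ∈ ball (0 : EuclideanSpace ℝ (Fin d)) 2 \ ball (0 : EuclideanSpace ℝ (Fin d)) 1,
        |g z| ≤ M) →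
      ContDiffOn ℝ 1 (extSweep d α c g) (ball (0 : EuclideanSpace ℝ (Fin d)) 1) ∧
      ∀ y ∈ ball (0 : EuclideanSpace ℝ (Fin d)) 1,
        IntegrableOn
          (fun z => g z • gradient (fun w => c * ‖w - z‖ ^ (-(d : ℝ) - α)) y)
          (ball (0 : EuclideanSpace ℝ (Fin d)) 1)ᶜ ∧
        HasGradientAt (extSweep d α c g)
          (∫ z in (ball (0 : EuclideanSpace ℝ (Fin d)) 1)ᶜ,
            g z • gradient (fun w => c * ‖w - z‖ ^ (-(d : ℝ) - α)) y) y ∧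
        ‖gradient (extSweep d α c g) y‖
          ≤ C * (1 - ‖y‖) ^ (-α - 1) *
            (M + ∫ z in (ball (0 : EuclideanSpace ℝ (Fin d)) 1)ᶜ,
              |g z| * min 1 (‖z‖ ^ (-(d : ℝ) - α))) := by
  obtain ⟨hα₀, -⟩ := hα
  have : NeZero d := ⟨by omega⟩
  set E := EuclideanSpace ℝ (Fin d)
  set s : ℝ := -(d : ℝ) - α with hs_def
  have hd₀ : (0 : ℝ) < d := by positivity
  have hs : s < 0 := by rw [hs_def]; linarith
  have hrank : (Module.finrank ℝ E : ℝ) = d := by simp [E]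
  set I := ∫ u in (ball (0 : E) 1)ᶜ, ‖u‖ ^ (s - 1)
  have hI : 0 ≤ I := integral_nonneg fun u => by positivity
  refine ⟨|c * s| * (I + (1 / 2) ^ (s - 1)), ?_, ?_⟩
  · have : 0 < |c * s| := abs_pos.2 (mul_ne_zero hc.ne' hs.ne)
    positivity
  intro g hg _ hint M hM
  have hmin : ∀ z ∈ (ball (0 : E) 1)ᶜ, |g z| * min 1 (‖z‖ ^ s) = |g z| * ‖z‖ ^ s :=
    fun z hz => by
      rw [min_eq_right (Real.rpow_le_one_of_one_le_of_nonpos (by simpa using hz) hs.le)]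
  replace hint : IntegrableOn (fun z => |g z| * ‖z‖ ^ s) (ball (0 : E) 1)ᶜ :=
    hint.congr_fun hmin measurableSet_ball.compl
  have hM₀ : 0 ≤ M := (abs_nonneg _).trans
    (hM (EuclideanSpace.single 0 1) (by simp))
  have hkernel : ∀ y ∈ ball (0 : E) 1, ∀ z ∈ (ball (0 : E) 1)ᶜ,
      g z • gradient (fun w => c * ‖w - z‖ ^ s) y =
        g z • ((c * s * ‖y - z‖ ^ (s - 2)) • (y - z)) := fun y hy z hz => by
    rw [(hasGradientAt_const_mul_norm_sub_rpow c s
      (ne_of_mem_unitBall_of_one_le_norm hy (by simpa using hz))).gradient]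
  have hgrad : ∀ y ∈ ball (0 : E) 1, HasGradientAt (extSweep d α c g)
      (∫ z in (ball (0 : E) 1)ᶜ, g z • ((c * s * ‖y - z‖ ^ (s - 2)) • (y - z))) y :=
    fun y hy => hasGradientAt_setIntegral_mul_rpow hg hs.le hint hy
  refine ⟨?_, fun y hy => ⟨?_, ?_, ?_⟩⟩
  · rw [← zero_add (1 : WithTop ℕ∞), contDiffOn_succ_iff_fderiv_of_isOpen isOpen_ball]
    refine ⟨fun y hy => (hgrad y hy).hasFDerivAt.differentiableAt.differentiableWithinAt,
      by simp, contDiffOn_zero.2 ?_⟩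
    exact ((InnerProductSpace.toDual ℝ E).continuous.comp_continuousOn
      (continuousOn_setIntegral_smul_rpow_smul hg hs.le hint)).congr
      fun y hy => (hgrad y hy).hasFDerivAt.fderiv
  · exact (integrableOn_smul_rpow_smul hg hs.le hint hy).congr_fun
      (fun z hz => (hkernel y hy z hz).symm) measurableSet_ball.compl
  · rw [setIntegral_congr_fun measurableSet_ball.compl (hkernel y hy)]
    exact hgrad y hy
  · rw [(hgrad y hy).gradient, setIntegral_congr_fun measurableSet_ball.compl hmin]
    refine (norm_setIntegral_smul_rpow_smul_le hs.le (by rw [hrank, hs_def]; linarith) hint hM₀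
      hM hy).trans ?_
    have hexp : s - 1 + Module.finrank ℝ E = -α - 1 := by rw [hrank, hs_def]; ring
    rw [hexp]
    set J := ∫ z in (ball (0 : E) 1)ᶜ, |g z| * ‖z‖ ^ s
    have hJ : 0 ≤ J := integral_nonneg fun z => by positivity
    set D := (1 - ‖y‖) ^ (-α - 1)
    have hD : 1 ≤ D := Real.one_le_rpow_of_pos_of_le_one_of_nonpos
      (by linarith [mem_ball_zero_iff.1 hy]) (by linarith [norm_nonneg y]) (by linarith)
    set B : ℝ := (1 / 2) ^ (s - 1)
    have hB : 0 ≤ B := by positivity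
    have h₁ : 0 ≤ I * D * J := by positivity
    have h₂ : 0 ≤ B * D * M := by positivity
    have h₃ : B * J ≤ B * J * D := le_mul_of_one_le_right (by positivity) hD
    rw [mul_assoc, mul_assoc]
    refine mul_le_mul_of_nonneg_left ?_ (abs_nonneg _)
    linarith
end
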